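/- Let S ⊆ ℝⁿ (n ≥ 2) be a centrally symmetric convex body of class C²₊ (C² boundary with everywhere strictly positive Gauss curvature). Then there is a nonnegative function Ψ with Ψ(δ) → 0 as δ → 0 such that for all sufficiently small δ > 0, (1 − (1 + Ψ(δ))·(c̃(S,n)/G_min)·δ^{2/(n+1)})·S ⊆ ((S°)^δ)° ⊆ (1 − (1 − Ψ(δ))·(c̃(S,n)/G_max)·δ^{2/(n+1)})·S, where c̃(S,n) = n^{2/(n+1)}·c(S,n)·c(S°,n). -/

import Mathlib

open MeasureTheory Metric Set Filter
open scoped RealInnerProductSpace Pointwise Topology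

noncomputable section

abbrev Euc (n : ℕ) : Type := EuclideanSpace ℝ (Fin n)

/-- A centrally symmetric convex body in `ℝⁿ`. -/
def IsSymConvexBody {n : ℕ} (S : Set (Euc n)) : Prop :=
  IsCompact S ∧ Convex ℝ S ∧ (interior S).Nonempty ∧ S = -S

/-- The convex floating body `K_δ`: the intersection of all closed halfspaces whose bounding
hyperplane cuts off a set of volume at most `δ·|K|ₙ` from `K`. -/
def floatingBody {n : ℕ} (K : Set (Euc n)) (δ : ℝ) : Set (Euc n) :=
  ⋂ (v : Euc n) (_ : v ≠ 0) (c : ℝ)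
    (_ : volume (K ∩ {y | c ≤ ⟪v, y⟫}) ≤ ENNReal.ofReal δ * volume K),
    {y | ⟪v, y⟫ ≤ c}

/-- The illumination body `K^δ`. -/
def illuminationBody {n : ℕ} (K : Set (Euc n)) (δ : ℝ) : Set (Euc n) :=
  {x | volume (convexHull ℝ (K ∪ {x})) ≤ ENNReal.ofReal (1 + δ) * volume K}

/-- The polar body `K°`. -/
def polarBody {n : ℕ} (K : Set (Euc n)) : Set (Euc n) :=
  {y | ∀ x ∈ K, ⟪x, y⟫ ≤ 1}

/-- The distance `d(C₁, C₂) = inf {a ≥ 1 : a⁻¹ C₁ ⊆ C₂ ⊆ a C₁}`. -/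
def bodyDist {n : ℕ} (C₁ C₂ : Set (Euc n)) : ℝ :=
  sInf {a : ℝ | 1 ≤ a ∧ a⁻¹ • C₁ ⊆ C₂ ∧ C₂ ⊆ a • C₁}

/-- `d_C(δ) = inf_{δ' > 0} d(C_δ, ((C°)^{δ'})°)`. -/
def dualDist {n : ℕ} (C : Set (Euc n)) (δ : ℝ) : ℝ :=
  sInf {r : ℝ | ∃ δ' > (0:ℝ), r = bodyDist (floatingBody C δ)
      (polarBody (illuminationBody (polarBody C) δ'))}

/-- `ν` is an outer unit normal of `S` at `x`. -/
def IsOuterNormalAt {n : ℕ} (S : Set (Euc n)) (x ν : Euc n) : Prop :=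
  ‖ν‖ = 1 ∧ ∀ y ∈ S, ⟪y, ν⟫ ≤ ⟪x, ν⟫

/-- Near `x ∈ ∂S`, the boundary of `S` is the graph of a `C²` function `f` over the tangent
hyperplane at `x` (embedded via a linear isometry `L` orthogonal to the normal `ν`), with
`f 0 = 0` and vanishing derivative at `0`, and `k` is the determinant of the Hessian of `f`
at `0`, i.e. the Gauss curvature of `∂S` at `x`. -/
def IsGaussCurvatureAt {n : ℕ} (S : Set (Euc n)) (x ν : Euc n) (k : ℝ) : Prop :=
  ∃ (L : Euc (n-1) →ₗᵢ[ℝ] Euc n) (f : Euc (n-1) → ℝ) (τ ε : ℝ),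
    0 < τ ∧ 0 < ε ∧
    (∀ v, ⟪L v, ν⟫ = 0) ∧
    ContDiffOn ℝ 2 f (ball 0 τ) ∧
    f 0 = 0 ∧ fderiv ℝ f 0 = 0 ∧
    frontier S ∩ ball x ε
      = {y | ∃ v ∈ ball (0 : Euc (n-1)) τ, y = x + L v - f v • ν} ∩ ball x ε ∧
    k = (Matrix.of fun i j : Fin (n-1) =>
      iteratedFDeriv ℝ 2 f 0 ![EuclideanSpace.single i 1, EuclideanSpace.single j 1]).det

/-- `S` has `C²` boundary, with outer unit normal map `u` and Gauss curvature function `κ`. -/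
def IsC2Body {n : ℕ} (S : Set (Euc n)) (u : Euc n → Euc n) (κ : Euc n → ℝ) : Prop :=
  ∀ x ∈ frontier S, IsOuterNormalAt S x (u x) ∧ IsGaussCurvatureAt S x (u x) (κ x)

/-- The constant `c(K, n) = ((n+1)^{2/(n+1)}/2)·(|K|ₙ/|B₂^{n−1}|_{n−1})^{2/(n+1)}`. -/
def cConst (n : ℕ) (K : Set (Euc n)) : ℝ :=
  ((n + 1 : ℝ) ^ ((2:ℝ)/(n+1)) / 2) *
    ((volume K).toReal / (volume (ball (0 : Euc (n-1)) 1)).toReal) ^ ((2:ℝ)/(n+1))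

/-- The function `G_S(x) = c(S,n)·κ(x)^{1/(n+1)} / ⟨x, u(x)⟩`. -/
def Gfun {n : ℕ} (S : Set (Euc n)) (u : Euc n → Euc n) (κ : Euc n → ℝ) (x : Euc n) : ℝ :=
  cConst n S * (κ x) ^ ((1:ℝ)/(n+1)) / ⟪x, u x⟫

theorem exists_inner_separating {n : ℕ} {C : Set (Euc n)} (hC : Convex ℝ C) (hcl : IsClosed C)
    (h0 : (0 : Euc n) ∈ C) {z : Euc n} (hz : z ∉ C) :
    ∃ x : Euc n, (∀ c ∈ C, ⟪x, c⟫ ≤ 1) ∧ 1 < ⟪x, z⟫ := by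
  obtain ⟨f, r, hf, hr⟩ := geometric_hahn_banach_closed_point hC hcl hz
  have hr0 : 0 < r := by simpa using hf 0 h0
  refine ⟨r⁻¹ • (InnerProductSpace.toDual ℝ (Euc n)).symm f, fun c hc => ?_, ?_⟩
  · rw [inner_smul_left, InnerProductSpace.toDual_symm_apply]
    have := hf c hc
    simp only [conj_trivial]
    rw [inv_mul_le_iff₀ hr0]; linarith
  · rw [inner_smul_left, InnerProductSpace.toDual_symm_apply]
    simp only [conj_trivial]
    rw [lt_inv_mul_iff₀ hr0]; linarith

theorem polarBody_convex {n : ℕ} (S : Set (Euc n)) : Convex ℝ (polarBody S) := by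
  intro y hy z hz a b ha hb hab x hx
  have h1 := hy x hx
  have h2 := hz x hx
  rw [inner_add_right, inner_smul_right, inner_smul_right]
  nlinarith

theorem polarBody_isClosed {n : ℕ} (S : Set (Euc n)) : IsClosed (polarBody S) := by
  have : polarBody S = ⋂ x ∈ S, {y | ⟪x, y⟫ ≤ 1} := by ext; simp [polarBody]
  rw [this]
  exact isClosed_biInter fun x _ => isClosed_le (by fun_prop) continuous_const

theorem zero_mem_polarBody {n : ℕ} (S : Set (Euc n)) : (0 : Euc n) ∈ polarBody S := by
  intro x _; simp

theorem IsSymConvexBody.exists_ball_subset {n : ℕ} {S : Set (Euc n)} (hS : IsSymConvexBody S) :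
    ∃ r > 0, closedBall (0 : Euc n) r ⊆ S := by
  obtain ⟨-, hconv, ⟨x, hx⟩, hsym⟩ := hS
  have hx' : -x ∈ interior S := by
    have h : -x ∈ Homeomorph.neg (Euc n) '' interior S := ⟨x, hx, rfl⟩
    rw [(Homeomorph.neg (Euc n)).image_interior] at h
    have e : Homeomorph.neg (Euc n) '' S = S := by
      rw [Homeomorph.coe_neg, image_neg_eq_neg, ← hsym]
    rwa [e] at h
  have h0 : (0 : Euc n) ∈ interior S := by
    have := hconv.interior hx hx' (by norm_num : (0 : ℝ) ≤ 1 / 2) (by norm_num : (0 : ℝ) ≤ 1 / 2)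
      (by norm_num)
    simpa using this
  rw [mem_interior_iff_mem_nhds, Metric.nhds_basis_closedBall.mem_iff] at h0
  exact h0

theorem IsSymConvexBody.zero_mem {n : ℕ} {S : Set (Euc n)} (hS : IsSymConvexBody S) :
    (0 : Euc n) ∈ S := by
  obtain ⟨r, hr, h⟩ := hS.exists_ball_subset
  exact h (by simp [hr.le])

theorem IsSymConvexBody.polarBody_subset_closedBall {n : ℕ} {S : Set (Euc n)}
    (hS : IsSymConvexBody S) : ∃ R > 0, polarBody S ⊆ closedBall 0 R := by
  obtain ⟨r, hr, h⟩ := hS.exists_ball_subset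
  refine ⟨r⁻¹, inv_pos.2 hr, fun y hy => ?_⟩
  rw [mem_closedBall_zero_iff]
  by_cases hy0 : y = 0
  · simp [hy0, hr.le]
  have hn : 0 < ‖y‖ := norm_pos_iff.2 hy0
  have hm : (r / ‖y‖) • y ∈ S := h (by
    rw [mem_closedBall_zero_iff, norm_smul, Real.norm_eq_abs, abs_of_pos (by positivity)]
    field_simp; rfl)
  have := hy _ hm
  rw [inner_smul_left, real_inner_self_eq_norm_sq] at this
  simp only [conj_trivial] at this
  rw [← one_div, le_div_iff₀ hr]
  have e : r / ‖y‖ * ‖y‖ ^ 2 = ‖y‖ * r := by field_simp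
  linarith

theorem IsSymConvexBody.polarBody_isCompact {n : ℕ} {S : Set (Euc n)}
    (hS : IsSymConvexBody S) : IsCompact (polarBody S) := by
  obtain ⟨R, -, h⟩ := hS.polarBody_subset_closedBall
  exact (isCompact_closedBall 0 R).of_isClosed_subset (polarBody_isClosed S) h

theorem IsSymConvexBody.ball_subset_polarBody {n : ℕ} {S : Set (Euc n)}
    (hS : IsSymConvexBody S) : ∃ r > 0, closedBall 0 r ⊆ polarBody S := by
  obtain ⟨R, hR0, hR⟩ := (hS.1.isBounded).subset_closedBall_lt 0 0
  refine ⟨R⁻¹, inv_pos.2 hR0, fun y hy x hx => ?_⟩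
  have h1 := hR hx
  rw [mem_closedBall_zero_iff] at h1 hy
  calc ⟪x, y⟫ ≤ ‖x‖ * ‖y‖ := real_inner_le_norm x y
    _ ≤ R * R⁻¹ := by gcongr
    _ = 1 := mul_inv_cancel₀ hR0.ne'

theorem IsSymConvexBody.volume_polarBody_pos {n : ℕ} {S : Set (Euc n)}
    (hS : IsSymConvexBody S) : 0 < volume (polarBody S) := by
  obtain ⟨r, hr, h⟩ := hS.ball_subset_polarBody
  exact (measure_closedBall_pos volume 0 hr).trans_le (measure_mono h)

theorem IsSymConvexBody.volume_pos {n : ℕ} {S : Set (Euc n)}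
    (hS : IsSymConvexBody S) : 0 < volume S := by
  obtain ⟨r, hr, h⟩ := hS.exists_ball_subset
  exact (measure_closedBall_pos volume 0 hr).trans_le (measure_mono h)

theorem exists_mem_polarBody_of_notMem {n : ℕ} {S : Set (Euc n)}
    (hS : IsSymConvexBody S) {z : Euc n} (hz : z ∉ S) : ∃ y ∈ polarBody S, 1 < ⟪z, y⟫ := by
  obtain ⟨y, hy, h⟩ := exists_inner_separating hS.2.1 hS.1.isClosed hS.zero_mem hz
  exact ⟨y, fun x hx => by rw [real_inner_comm]; exact hy x hx, by rwa [real_inner_comm]⟩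

/-- A pair of polar boundary points of `S` and `S°`. -/
def IsContactPair {n : ℕ} (S : Set (Euc n)) (x y : Euc n) : Prop :=
  x ∈ S ∧ y ∈ polarBody S ∧ ⟪x, y⟫ = 1

theorem IsContactPair.mem_frontier {n : ℕ} {S : Set (Euc n)} {x y : Euc n}
    (h : IsContactPair S x y) : x ∈ frontier S := by
  obtain ⟨hx, hy, hxy⟩ := h
  refine ⟨subset_closure hx, fun hi => ?_⟩
  have hy0 : y ≠ 0 := by rintro rfl; simp at hxy
  have : Tendsto (fun t : ℝ => x + t • y) (𝓝 0) (𝓝 x) := by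
    have : Continuous (fun t : ℝ => x + t • y) := by fun_prop
    simpa using this.tendsto 0
  have h1 := this.eventually (mem_interior_iff_mem_nhds.1 hi)
  obtain ⟨t, ht, ht0⟩ := ((h1.filter_mono nhdsWithin_le_nhds).and
    (self_mem_nhdsWithin : Ioi (0 : ℝ) ∈ 𝓝[>] 0)).exists
  have := hy _ ht
  rw [inner_add_left, inner_smul_left, hxy, real_inner_self_eq_norm_sq] at this
  have hn : 0 < ‖y‖ := norm_pos_iff.2 hy0
  simp only [conj_trivial] at this
  have : 0 < t * ‖y‖ ^ 2 := mul_pos ht0 (by positivity)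
  linarith

theorem IsOuterNormalAt.inner_pos {n : ℕ} {S : Set (Euc n)} (hS : IsSymConvexBody S)
    {x ν : Euc n} (h : IsOuterNormalAt S x ν) : 0 < ⟪x, ν⟫ := by
  obtain ⟨r, hr, hb⟩ := hS.exists_ball_subset
  have := h.2 (r • ν) (hb (by simp [norm_smul, h.1, abs_of_pos hr]))
  rw [inner_smul_left, real_inner_self_eq_norm_sq, h.1] at this
  simp only [conj_trivial] at this
  linarith

theorem IsOuterNormalAt.isContactPair {n : ℕ} {S : Set (Euc n)} (hS : IsSymConvexBody S)
    {x ν : Euc n} (hx : x ∈ frontier S) (h : IsOuterNormalAt S x ν) :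
    IsContactPair S x (⟪x, ν⟫⁻¹ • ν) := by
  have hp := h.inner_pos hS
  refine ⟨hS.1.isClosed.frontier_subset hx, fun z hz => ?_, ?_⟩
  · rw [inner_smul_right, inv_mul_le_iff₀ hp, mul_one]; exact h.2 z hz
  · rw [inner_smul_right, inv_mul_cancel₀ hp.ne']

/-- Every nonzero vector is a positive multiple of a point in contact with `S`. -/
theorem exists_isContactPair_smul {n : ℕ} {S : Set (Euc n)} (hS : IsSymConvexBody S)
    {z : Euc n} (hz : z ≠ 0) :
    ∃ x y : Euc n, ∃ t > 0, IsContactPair S x y ∧ z = t • y ∧ t = ⟪x, z⟫ := by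
  obtain ⟨x, hx, hmax⟩ := hS.1.exists_isMaxOn ⟨0, hS.zero_mem⟩
    (f := fun x => ⟪x, z⟫) (by fun_prop)
  obtain ⟨r, hr, hb⟩ := hS.exists_ball_subset
  have hn : 0 < ‖z‖ := norm_pos_iff.2 hz
  have hpos : 0 < ⟪x, z⟫ := by
    have h1 : (r / ‖z‖) • z ∈ S := hb (by
      rw [mem_closedBall_zero_iff, norm_smul, Real.norm_eq_abs, abs_of_pos (by positivity)]
      field_simp; rfl)
    have h2 := hmax h1
    simp only [mem_ofPred_eq, inner_smul_left, real_inner_self_eq_norm_sq, conj_trivial] at h2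
    have : 0 < r / ‖z‖ * ‖z‖ ^ 2 := by positivity
    linarith
  refine ⟨x, ⟪x, z⟫⁻¹ • z, _, hpos, ⟨hx, fun w hw => ?_, ?_⟩, ?_, rfl⟩
  · rw [inner_smul_right, inv_mul_le_iff₀ hpos, mul_one]; exact hmax hw
  · rw [inner_smul_right, inv_mul_cancel₀ hpos.ne']
  · rw [smul_smul, mul_inv_cancel₀ hpos.ne', one_smul]

theorem mem_convexHull_union_singleton {E : Type*} [AddCommGroup E] [Module ℝ E] {K : Set E}
    (hK : Convex ℝ K) (hne : K.Nonempty) {p z : E} :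
    z ∈ convexHull ℝ (K ∪ {p}) ↔ ∃ k ∈ K, ∃ t ∈ Icc (0 : ℝ) 1, z = (1 - t) • k + t • p := by
  rw [union_singleton, convexHull_insert hne, hK.convexHull_eq, mem_convexJoin]
  constructor
  · rintro ⟨a, rfl, k, hk, hz⟩
    rw [segment_eq_image] at hz
    obtain ⟨t, ht, rfl⟩ := hz
    refine ⟨k, hk, 1 - t, ⟨by linarith [ht.2], by linarith [ht.1]⟩, ?_⟩
    simp only [sub_sub_cancel]; rw [add_comm]
  · rintro ⟨k, hk, t, ht, rfl⟩
    refine ⟨p, rfl, k, hk, ?_⟩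
    rw [segment_symm, segment_eq_image]
    exact ⟨t, ht, rfl⟩

theorem isCompact_convexHull_union_singleton {n : ℕ} {K : Set (Euc n)}
    (hK : Convex ℝ K) (hne : K.Nonempty) (hc : IsCompact K) (p : Euc n) :
    IsCompact (convexHull ℝ (K ∪ {p})) := by
  have : convexHull ℝ (K ∪ {p}) =
      (fun q : Euc n × ℝ => (1 - q.2) • q.1 + q.2 • p) '' (K ×ˢ Icc 0 1) := by
    ext z
    rw [mem_convexHull_union_singleton hK hne]
    constructor
    · rintro ⟨k, hk, t, ht, rfl⟩; exact ⟨(k, t), ⟨hk, ht⟩, rfl⟩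
    · rintro ⟨⟨k, t⟩, ⟨hk, ht⟩, rfl⟩; exact ⟨k, hk, t, ht, rfl⟩
  rw [this]
  exact (hc.prod isCompact_Icc).image (by fun_prop)

/-- The part of the convex hull of `S°` and `p` lying outside `S°`. -/
def polarCap {n : ℕ} (S : Set (Euc n)) (p : Euc n) : Set (Euc n) :=
  convexHull ℝ (polarBody S ∪ {p}) \ polarBody S

theorem mem_polarCap_iff {n : ℕ} {S : Set (Euc n)} (hS : IsSymConvexBody S) {p z : Euc n} :
    z ∈ polarCap S p ↔
      (∃ x ∈ S, 1 < ⟪x, z⟫) ∧ ∀ x ∈ S, ⟪x, p⟫ ≤ 1 → ⟪x, z⟫ ≤ 1 := by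
  have hne : (polarBody S).Nonempty := ⟨0, zero_mem_polarBody S⟩
  rw [polarCap, Set.mem_sdiff, and_comm]
  refine and_congr (by simp [polarBody]) ⟨fun hz x hx hp => ?_, fun h => ?_⟩
  · obtain ⟨k, hk, t, ht, rfl⟩ := (mem_convexHull_union_singleton (polarBody_convex S) hne).1 hz
    have := hk x hx
    rw [inner_add_right, inner_smul_right, inner_smul_right]
    nlinarith [ht.1, ht.2]
  · by_contra hz
    have hc := isCompact_convexHull_union_singleton (polarBody_convex S) hne
      hS.polarBody_isCompact p
    obtain ⟨x, hx, hxz⟩ := exists_inner_separating (convex_convexHull ℝ _) hc.isClosed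
      (subset_convexHull ℝ _ (Or.inl (zero_mem_polarBody S))) hz
    have hxS : x ∈ S := by
      by_contra hxS
      obtain ⟨y, hy, hxy⟩ := exists_mem_polarBody_of_notMem hS hxS
      linarith [hx y (subset_convexHull ℝ _ (Or.inl hy))]
    linarith [h x hxS (hx p (subset_convexHull ℝ _ (Or.inr rfl)))]

theorem measurableSet_polarCap {n : ℕ} {S : Set (Euc n)} (hS : IsSymConvexBody S) (p : Euc n) :
    MeasurableSet (polarCap S p) :=
  (isCompact_convexHull_union_singleton (polarBody_convex S) ⟨0, zero_mem_polarBody S⟩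
    hS.polarBody_isCompact p).measurableSet.diff (polarBody_isClosed S).measurableSet

theorem volume_polarCap_ne_top {n : ℕ} {S : Set (Euc n)} (hS : IsSymConvexBody S) (p : Euc n) :
    volume (polarCap S p) ≠ ⊤ :=
  ((measure_mono sdiff_subset).trans_lt
    (isCompact_convexHull_union_singleton (polarBody_convex S) ⟨0, zero_mem_polarBody S⟩
    hS.polarBody_isCompact p).measure_lt_top).ne

theorem mem_illuminationBody_polarBody_iff {n : ℕ} {S : Set (Euc n)} (hS : IsSymConvexBody S)
    {p : Euc n} {δ : ℝ} (hδ : 0 ≤ δ) :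
    p ∈ illuminationBody (polarBody S) δ ↔
      (volume (polarCap S p)).toReal ≤ δ * (volume (polarBody S)).toReal := by
  have hK : volume (polarBody S) ≠ ⊤ := hS.polarBody_isCompact.measure_lt_top.ne
  have h1 : volume (convexHull ℝ (polarBody S ∪ {p})) =
      volume (polarCap S p) + volume (polarBody S) := by
    rw [polarCap, measure_sdiff_add_inter _ (polarBody_isClosed S).measurableSet |>.symm]
    congr 2
    exact inter_eq_self_of_subset_right
      (subset_union_left.trans (subset_convexHull ℝ (polarBody S ∪ {p})))
  rw [illuminationBody, mem_ofPred_eq, h1, ENNReal.ofReal_add zero_le_one hδ, add_mul,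
    ENNReal.ofReal_one, one_mul, add_comm (volume (polarBody S)),
    ENNReal.add_le_add_iff_right hK, ← ENNReal.toReal_le_toReal (volume_polarCap_ne_top hS p)
      (ENNReal.mul_ne_top ENNReal.ofReal_ne_top hK), ENNReal.toReal_mul, ENNReal.toReal_ofReal hδ]

theorem polarCap_smul_subset {n : ℕ} {S : Set (Euc n)} (hS : IsSymConvexBody S) {y : Euc n}
    {s t : ℝ} (hs : 1 ≤ s) (hst : s ≤ t) :
    polarCap S (s • y) ⊆ polarCap S (t • y) := by
  intro z hz
  rw [mem_polarCap_iff hS] at hz ⊢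
  refine ⟨hz.1, fun x hx h => hz.2 x hx ?_⟩
  rw [inner_smul_right] at h ⊢
  rcases le_total 0 ⟪x, y⟫ with h0 | h0
  · nlinarith
  · nlinarith

open scoped MatrixOrder in
theorem exists_isSymmetric_sqrt_of_bilinear {d : ℕ} (Q : Euc d →L[ℝ] Euc d →L[ℝ] ℝ)
    (hsymm : ∀ v w, Q v w = Q w v) (hpos : ∀ v, 0 ≤ Q v v) :
    ∃ B : Euc d →ₗ[ℝ] Euc d, B.IsSymmetric ∧ (∀ v, ‖B v‖ ^ 2 = Q v v) ∧
      LinearMap.det B ^ 2 = (Matrix.of fun i j : Fin d =>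
        Q (EuclideanSpace.single i 1) (EuclideanSpace.single j 1)).det := by
  set M : Matrix (Fin d) (Fin d) ℝ := Matrix.of fun i j : Fin d =>
        Q (EuclideanSpace.single i 1) (EuclideanSpace.single j 1) with hM
  have hsum : ∀ v : Euc d, v = ∑ i, v i • EuclideanSpace.single i (1 : ℝ) := by
    intro v
    ext j
    simp [Finset.sum_apply, Pi.single_apply]
  have hQ : ∀ v : Euc d, Q v v = v.ofLp ⬝ᵥ M.mulVec v.ofLp := by
    intro v
    conv_lhs => rw [hsum v]
    simp only [map_sum, map_smul, _root_.sum_apply, _root_.smul_apply,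
      dotProduct, Matrix.mulVec, hM, Matrix.of_apply, smul_eq_mul, Finset.mul_sum]
    rw [Finset.sum_comm]
    refine Finset.sum_congr rfl fun i _ => Finset.sum_congr rfl fun j _ => ?_
    ring
  have hMps : M.PosSemidef := by
    refine Matrix.PosSemidef.of_dotProduct_mulVec_nonneg ?_ fun v => ?_
    · ext i j
      simp [hM, hsymm (EuclideanSpace.single j 1)]
    · have := hQ (WithLp.toLp 2 v)
      simp only [star_trivial]
      rw [← this]; exact hpos _
  have hsq : CFC.sqrt M * CFC.sqrt M = M := CFC.sqrt_mul_sqrt_self M hMps.nonneg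
  have hh : (CFC.sqrt M).IsHermitian :=
    (Matrix.nonneg_iff_posSemidef.1 (CFC.sqrt_nonneg M)).isHermitian
  have hB : (Matrix.toEuclideanLin (CFC.sqrt M)).IsSymmetric :=
    Matrix.isSymmetric_toEuclideanLin_iff.2 hh
  refine ⟨Matrix.toEuclideanLin (CFC.sqrt M), hB, fun v => ?_, ?_⟩
  · rw [← real_inner_self_eq_norm_sq, hB, hQ]
    rw [← LinearMap.comp_apply, EuclideanSpace.inner_eq_star_dotProduct]
    simp only [LinearMap.comp_apply, Matrix.toEuclideanLin, Matrix.ofLp_toLpLin,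
      Matrix.toLin'_apply, Matrix.mulVec_mulVec, hsq, star_trivial]
    exact dotProduct_comm _ _
  · rw [Matrix.toEuclideanLin_eq_toLin_orthonormal, LinearMap.det_toLin, sq, ← Matrix.det_mul, hsq]

theorem exists_second_order_taylor {d : ℕ} {f : Euc d → ℝ} {τ : ℝ} (hτ : 0 < τ)
    (hf : ContDiffOn ℝ 2 f (ball 0 τ)) {ε : ℝ} (hε : 0 < ε) :
    ∃ r > 0, r ≤ τ ∧ ∀ v ∈ ball (0 : Euc d) r, ∀ v' ∈ ball (0 : Euc d) r,
      |f v' - f v - fderiv ℝ f v (v' - v) - fderiv ℝ (fderiv ℝ f) 0 (v' - v) (v' - v) / 2|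
        ≤ ε * ‖v' - v‖ ^ 2 := by
  have hfa : ∀ v ∈ ball (0 : Euc d) τ, ContDiffAt ℝ 2 f v := fun v hv =>
    (hf v hv).contDiffAt (isOpen_ball.mem_nhds hv)
  have h0 : ContDiffAt ℝ 2 f 0 := hfa 0 (by simpa using hτ)
  set H := fderiv ℝ (fderiv ℝ f) 0 with hH
  have hsymm : ∀ v w, H v w = H w v :=
    h0.isSymmSndFDerivAt (by simp)
  have hstrict : HasStrictFDerivAt (fderiv ℝ f) H 0 :=
    (h0.fderiv_right (m := 1) (by norm_num)).hasStrictFDerivAt (by norm_num)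
  have h1 := (hasStrictFDerivAt_iff_isLittleO.1 hstrict).def hε
  rw [nhds_prod_eq] at h1
  obtain ⟨t, ht, hst⟩ := Filter.mem_prod_self_iff.1 h1
  obtain ⟨r, hr, hrt⟩ := Metric.mem_nhds_iff.1 ht
  refine ⟨min r τ, lt_min hr hτ, min_le_right _ _, fun v hv v' hv' => ?_⟩
  have hseg : segment ℝ v v' ⊆ ball (0 : Euc d) (min r τ) :=
    (convex_ball _ _).segment_subset hv hv'
  have hder : ∀ u ∈ segment ℝ v v', HasFDerivWithinAt
      (fun u => f u - fderiv ℝ f v (u - v) - H (u - v) (u - v) / 2)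
      (fderiv ℝ f u - fderiv ℝ f v - H (u - v)) (segment ℝ v v') u := by
    intro u hu
    have hu' := hseg hu
    have e1 : HasFDerivAt f (fderiv ℝ f u) u :=
      ((hfa u (ball_subset_ball (min_le_right _ _) hu')).differentiableAt (by norm_num)).hasFDerivAt
    have e2 : HasFDerivAt (fun u => fderiv ℝ f v (u - v)) (fderiv ℝ f v) u := by
      exact (fderiv ℝ f v).hasFDerivAt.comp u ((hasFDerivAt_id u).sub_const v)
    have e3 : HasFDerivAt (fun u => H (u - v) (u - v) / 2) (H (u - v)) u := by
      have a1 : HasFDerivAt (fun u => H (u - v)) H u := by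
        exact H.hasFDerivAt.comp u ((hasFDerivAt_id u).sub_const v)
      have a2 : HasFDerivAt (fun u => u - v) (ContinuousLinearMap.id ℝ (Euc d)) u :=
        (hasFDerivAt_id u).sub_const v
      have a3 := (a1.clm_apply a2).const_mul (1 / 2 : ℝ)
      convert! a3 using 1
      · ext u; ring
      · ext w
        simp [hsymm w]
        ring
    exact ((e1.sub e2).sub e3).hasFDerivWithinAt
  have hbd : ∀ u ∈ segment ℝ v v', ‖fderiv ℝ f u - fderiv ℝ f v - H (u - v)‖ ≤ ε * ‖v' - v‖ := by
    intro u hu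
    have hu' := hseg hu
    have := hst (show (u, v) ∈ t ×ˢ t from ⟨hrt (ball_subset_ball (min_le_left _ _) hu'),
      hrt (ball_subset_ball (min_le_left _ _) hv)⟩)
    refine (show ‖fderiv ℝ f u - fderiv ℝ f v - H (u - v)‖ ≤ ε * ‖u - v‖ from this).trans ?_
    gcongr
    rw [segment_eq_image'] at hu
    obtain ⟨θ, hθ, rfl⟩ := hu
    simp only [add_sub_cancel_left, norm_smul, Real.norm_eq_abs, abs_of_nonneg hθ.1]
    exact mul_le_of_le_one_left (norm_nonneg _) hθ.2
  have := Convex.norm_image_sub_le_of_norm_hasFDerivWithin_le hder hbd (convex_segment v v')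
    (left_mem_segment ℝ v v') (right_mem_segment ℝ v v')
  simp only [sub_self, map_zero, Real.norm_eq_abs, zero_div,
    sub_zero] at this
  calc _ = _ := by congr 1; ring
    _ ≤ _ := this
    _ = _ := by ring

/-- The isometric splitting of `ℝⁿ` into a hyperplane and its unit normal. -/
def hyperplaneSplitting {d n : ℕ} (hdn : d + 1 = n) (L : Euc d →ₗᵢ[ℝ] Euc n) (ν : Euc n)
    (hν : ‖ν‖ = 1) (hL : ∀ v, ⟪L v, ν⟫ = 0) : WithLp 2 (Euc d × ℝ) ≃ₗᵢ[ℝ] Euc n :=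
  LinearIsometry.toLinearIsometryEquiv
    (LinearMap.isometryOfInner
      { toFun := fun p => L p.fst + p.snd • ν
        map_add' := fun p q => by simp only [WithLp.add_fst, WithLp.add_snd, map_add]; module
        map_smul' := fun c p => by
          simp only [WithLp.smul_fst, WithLp.smul_snd, map_smul, RingHom.id_apply]; module }
      (fun p q => by
        have h1 : ∀ v, ⟪ν, L v⟫ = 0 := fun v => by rw [real_inner_comm]; exact hL v
        simp [inner_add_left, inner_add_right, inner_smul_left, inner_smul_right, hL, h1, hν,
          WithLp.prod_inner_apply, mul_comm]))
    (by rw [(WithLp.linearEquiv 2 ℝ (Euc d × ℝ)).finrank_eq]; simp [hdn])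

theorem hyperplaneSplitting_apply {d n : ℕ} (hdn : d + 1 = n) (L : Euc d →ₗᵢ[ℝ] Euc n) (ν : Euc n)
    (hν : ‖ν‖ = 1) (hL : ∀ v, ⟪L v, ν⟫ = 0) (p : WithLp 2 (Euc d × ℝ)) :
    hyperplaneSplitting hdn L ν hν hL p = L p.fst + p.snd • ν := rfl

/-- The adjoint of an isometric embedding. -/
def isometryAdjoint {d n : ℕ} (L : Euc d →ₗᵢ[ℝ] Euc n) : Euc n →L[ℝ] Euc d :=
  ContinuousLinearMap.adjoint L.toContinuousLinearMap

theorem inner_isometryAdjoint {d n : ℕ} (L : Euc d →ₗᵢ[ℝ] Euc n) (y : Euc n) (v : Euc d) :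
    ⟪isometryAdjoint L y, v⟫ = ⟪y, L v⟫ :=
  ContinuousLinearMap.adjoint_inner_left L.toContinuousLinearMap v y

theorem isometryAdjoint_apply_self {d n : ℕ} (L : Euc d →ₗᵢ[ℝ] Euc n) (v : Euc d) :
    isometryAdjoint L (L v) = v := by
  refine ext_inner_right ℝ fun w => ?_
  rw [inner_isometryAdjoint, L.inner_map_map]

theorem isometryAdjoint_normal {d n : ℕ} (L : Euc d →ₗᵢ[ℝ] Euc n) {ν : Euc n}
    (hL : ∀ v, ⟪L v, ν⟫ = 0) : isometryAdjoint L ν = 0 := by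
  refine ext_inner_right ℝ fun w => ?_
  rw [inner_isometryAdjoint, real_inner_comm, hL, inner_zero_left]

theorem norm_isometryAdjoint_le {d n : ℕ} (L : Euc d →ₗᵢ[ℝ] Euc n) (y : Euc n) :
    ‖isometryAdjoint L y‖ ≤ ‖y‖ := by
  by_contra! h
  have h1 : ‖isometryAdjoint L y‖ ^ 2 ≤ ‖y‖ * ‖isometryAdjoint L y‖ := by
    rw [← real_inner_self_eq_norm_sq, inner_isometryAdjoint]
    exact (real_inner_le_norm _ _).trans (by rw [L.norm_map])
  nlinarith [norm_nonneg y]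

theorem eq_isometryAdjoint_add_normal {d n : ℕ} (hdn : d + 1 = n) (L : Euc d →ₗᵢ[ℝ] Euc n)
    {ν : Euc n} (hν : ‖ν‖ = 1) (hL : ∀ v, ⟪L v, ν⟫ = 0) (y : Euc n) :
    y = L (isometryAdjoint L y) + ⟪ν, y⟫ • ν := by
  obtain ⟨p, rfl⟩ := (hyperplaneSplitting hdn L ν hν hL).surjective y
  have h1 : ∀ v, ⟪ν, L v⟫ = 0 := fun v => by rw [real_inner_comm]; exact hL v
  rw [hyperplaneSplitting_apply, map_add, isometryAdjoint_apply_self, map_smul,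
    isometryAdjoint_normal L hL, inner_add_right, h1, inner_smul_right,
    real_inner_self_eq_norm_sq, hν]
  simp

theorem exists_radius_graph_contact {d n : ℕ} (hdn : d + 1 = n) {S : Set (Euc n)}
    (hS : IsSymConvexBody S)
    (hN : ∀ x ∈ frontier S, ∃ ν, IsOuterNormalAt S x ν) {x₀ ν : Euc n}
    (hx₀ : IsOuterNormalAt S x₀ ν) {L : Euc d →ₗᵢ[ℝ] Euc n} {f : Euc d → ℝ} {τ ε : ℝ}
    (hτ : 0 < τ) (hε : 0 < ε) (hL : ∀ v, ⟪L v, ν⟫ = 0) (hf : ContDiffOn ℝ 2 f (ball 0 τ))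
    (hf0 : f 0 = 0) (hf1 : fderiv ℝ f 0 = 0)
    (hgr : frontier S ∩ ball x₀ ε
      = {y | ∃ v ∈ ball (0 : Euc d) τ, y = x₀ + L v - f v • ν} ∩ ball x₀ ε) :
    ∃ ρ > 0, ρ ≤ τ ∧
      (∀ v ∈ ball (0 : Euc d) ρ, x₀ + L v - f v • ν ∈ S) ∧
      ∀ v ∈ ball (0 : Euc d) ρ, ∀ y, IsContactPair S (x₀ + L v - f v • ν) y →
        0 < ⟪ν, y⟫ ∧
        ⟪ν, y⟫ * (fderiv ℝ f v (isometryAdjoint L x₀ + v) + (⟪x₀, ν⟫ - f v)) = 1 ∧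
        (∀ w, ⟪L w, y⟫ = fderiv ℝ f v w * ⟪ν, y⟫) ∧
        (∀ v' ∈ ball (0 : Euc d) ρ, 1 - ⟪x₀ + L v' - f v' • ν, y⟫ =
          ⟪ν, y⟫ * (f v' - f v - fderiv ℝ f v (v' - v))) ∧
        ∀ x' ∈ S, isometryAdjoint L (x' - x₀) ∈ ball (0 : Euc d) ρ →
          ⟪ν, y⟫ * (f (isometryAdjoint L (x' - x₀)) - f v -
            fderiv ℝ f v (isometryAdjoint L (x' - x₀) - v)) ≤ 1 - ⟪x', y⟫ := by
  have hν := hx₀.1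
  have ha := hx₀.inner_pos hS
  set X : Euc d → Euc n := fun v => x₀ + L v - f v • ν with hX
  have hfa : ∀ v ∈ ball (0 : Euc d) τ, ContDiffAt ℝ 2 f v := fun v hv =>
    (hf v hv).contDiffAt (isOpen_ball.mem_nhds hv)
  have h0τ : (0 : Euc d) ∈ ball (0 : Euc d) τ := by simpa using hτ
  have hfc : ContinuousAt f 0 := (hfa 0 h0τ).continuousAt
  have hfd : ContinuousAt (fderiv ℝ f) 0 :=
    ((hfa 0 h0τ).fderiv_right (m := 1) (by norm_num)).continuousAt
  have hXc : ContinuousAt X 0 := by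
    have := L.continuous.continuousAt (x := (0 : Euc d))
    fun_prop
  have hX0 : X 0 = x₀ := by simp [hX, hf0]
  have hFc : ContinuousAt
      (fun v => fderiv ℝ f v (isometryAdjoint L x₀ + v) + (⟪x₀, ν⟫ - f v)) 0 := by
    fun_prop
  have hF0 : 0 < fderiv ℝ f 0 (isometryAdjoint L x₀ + 0) + (⟪x₀, ν⟫ - f 0) := by
    simpa [hf1, hf0] using ha
  have e1 : ∀ᶠ v in 𝓝 (0 : Euc d), X v ∈ ball x₀ ε :=
    hXc.eventually_mem (by rw [hX0]; exact ball_mem_nhds _ hε)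
  have e2 := hFc.eventually (lt_mem_nhds hF0)
  obtain ⟨r, hr, hrs⟩ := Metric.eventually_nhds_iff_ball.1 (e1.and e2)
  refine ⟨min r τ, lt_min hr hτ, min_le_right _ _, ?_⟩
  have hfr : ∀ v ∈ ball (0 : Euc d) (min r τ), X v ∈ frontier S := by
    intro v hv
    have : X v ∈ frontier S ∩ ball x₀ ε := by
      rw [hgr]
      exact ⟨⟨v, ball_subset_ball (min_le_right _ _) hv, rfl⟩,
        (hrs v (ball_subset_ball (min_le_left _ _) hv)).1⟩
    exact this.1
  have hXS : ∀ v ∈ ball (0 : Euc d) (min r τ), X v ∈ S := fun v hv =>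
    hS.1.isClosed.frontier_subset (hfr v hv)
  have hder : ∀ v ∈ ball (0 : Euc d) (min r τ), ∀ y, IsContactPair S (X v) y →
      ∀ w, ⟪L w, y⟫ = fderiv ℝ f v w * ⟪ν, y⟫ := by
    intro v hv y hy w
    have hmax : IsLocalMax (fun v' => ⟪X v', y⟫) v := by
      filter_upwards [isOpen_ball.mem_nhds hv] with v' hv'
      rw [hy.2.2]
      exact hy.2.1 _ (hXS v' hv')
    have hfv : HasFDerivAt f (fderiv ℝ f v) v :=
      ((hfa v (ball_subset_ball (min_le_right _ _) hv)).differentiableAt (by norm_num)).hasFDerivAt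
    have hd : HasFDerivAt (fun v' => ⟪x₀, y⟫ + ⟪y, L v'⟫ - f v' * ⟪ν, y⟫)
        ((innerSL ℝ y).comp L.toContinuousLinearMap - ⟪ν, y⟫ • fderiv ℝ f v) v := by
      have a1 : HasFDerivAt (fun v' => ⟪y, L v'⟫) ((innerSL ℝ y).comp L.toContinuousLinearMap) v :=
        ((innerSL ℝ y).comp L.toContinuousLinearMap).hasFDerivAt
      exact (a1.const_add _).sub (hfv.mul_const _)
    have he : (fun v' => ⟪X v', y⟫) = fun v' => ⟪x₀, y⟫ + ⟪y, L v'⟫ - f v' * ⟪ν, y⟫ := by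
      ext v'
      simp only [hX, inner_sub_left, inner_add_left, inner_smul_left, conj_trivial]
      rw [real_inner_comm y (L v')]
    rw [he] at hmax
    have := congrArg (fun g => g w) (hmax.hasFDerivAt_eq_zero hd)
    simp at this
    rw [real_inner_comm, mul_comm]; linarith
  have hFb : ∀ v ∈ ball (0 : Euc d) (min r τ), ∀ y, IsContactPair S (X v) y →
      ⟪ν, y⟫ * (fderiv ℝ f v (isometryAdjoint L x₀ + v) + (⟪x₀, ν⟫ - f v)) = 1 := by
    intro v hv y hy
    have h1 := hy.2.2
    have h2 : ⟪X v, y⟫ = ⟪L (isometryAdjoint L x₀ + v), y⟫ + (⟪x₀, ν⟫ - f v) * ⟪ν, y⟫ := by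
      conv_lhs => rw [hX]
      simp only [inner_sub_left, inner_add_left, inner_smul_left, conj_trivial, map_add]
      conv_lhs => rw [eq_isometryAdjoint_add_normal hdn L hν hL x₀]
      rw [inner_add_left, inner_smul_left, real_inner_comm ν x₀]
      simp only [conj_trivial]
      ring
    rw [h2, hder v hv y hy] at h1
    linarith
  have hbpos : ∀ v ∈ ball (0 : Euc d) (min r τ), ∀ y, IsContactPair S (X v) y → 0 < ⟪ν, y⟫ := by
    intro v hv y hy
    have h1 := hFb v hv y hy
    have h2 := (hrs v (ball_subset_ball (min_le_left _ _) hv)).2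
    by_contra! h
    nlinarith
  have hval : ∀ v ∈ ball (0 : Euc d) (min r τ), ∀ y, IsContactPair S (X v) y →
      ∀ v' : Euc d, 1 - ⟪X v', y⟫ = ⟪ν, y⟫ * (f v' - f v - fderiv ℝ f v (v' - v)) := by
    intro v hv y hy v'
    have h1 := hy.2.2
    have h3 := hder v hv y hy (v' - v)
    simp only [hX, inner_sub_left, inner_add_left, inner_smul_left, conj_trivial, map_sub]
      at h1 h3 ⊢
    linarith
  refine ⟨hXS, fun v hv y hy => ⟨hbpos v hv y hy, hFb v hv y hy, hder v hv y hy,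
    fun v' _ => hval v hv y hy v', fun x' hx' hb => ?_⟩⟩
  set v' := isometryAdjoint L (x' - x₀) with hv'
  rw [← hval v hv y hy v']
  have hdec := eq_isometryAdjoint_add_normal hdn L hν hL (x' - x₀)
  have hx'eq : x' = X v' + (⟪ν, x' - x₀⟫ + f v') • ν := by
    rw [hX]
    simp only
    rw [add_smul, ← hv'] at *
    rw [show x' = x₀ + (x' - x₀) by abel]
    conv_lhs => rw [hdec]
    simp only [add_sub_cancel_left]
    abel
  obtain ⟨ν', hν'⟩ := hN _ (hfr v' hb)
  have hc := hν'.isContactPair hS (hfr v' hb)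
  have hb' := hbpos v' hb _ hc
  have h1 := hc.2.1 x' hx'
  have h2 := hc.2.2
  have hb0 := hbpos v hv y hy
  have hle : ⟪ν, x' - x₀⟫ + f v' ≤ 0 := by
    rw [hx'eq, inner_add_left, h2, inner_smul_left] at h1
    simp only [conj_trivial] at h1
    by_contra! h
    have := mul_pos h hb'
    linarith
  have h4 : ⟪x', y⟫ = ⟪X v', y⟫ + (⟪ν, x' - x₀⟫ + f v') * ⟪ν, y⟫ := by
    conv_lhs => rw [hx'eq]
    rw [inner_add_left, inner_smul_left]
    rfl
  rw [h4]
  nlinarith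

/-- `S` is approximated to second order near its boundary point `x₀` with normal `ν` by the
quadratic form `v ↦ ‖B v‖ ^ 2` on the tangent hyperplane, uniformly over nearby contact pairs. -/
def HasLocalModel {d n : ℕ} (S : Set (Euc n)) (x₀ ν : Euc n) (L : Euc d →ₗᵢ[ℝ] Euc n)
    (B : Euc d →ₗ[ℝ] Euc d) : Prop :=
  ∀ ε > 0, ∃ r > 0, ∃ c > 0, ∀ x y, IsContactPair S x y → ‖x - x₀‖ < r →
    ‖y - ⟪x₀, ν⟫⁻¹ • ν‖ ≤ ε ∧
    (∀ w : Euc d, ‖w‖ < r → ∃ x' ∈ S, isometryAdjoint L (x' - x) = w ∧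
      |1 - ⟪x', y⟫ - ‖B w‖ ^ 2| ≤ ε * ‖B w‖ ^ 2) ∧
    ∀ x' ∈ S, 1 - ⟪x', y⟫ < c →
      (1 - ε) * ‖B (isometryAdjoint L (x' - x))‖ ^ 2 ≤ 1 - ⟪x', y⟫

theorem hasLocalModel_of_graph {d n : ℕ} (hdn : d + 1 = n) {S : Set (Euc n)}
    (hS : IsSymConvexBody S)
    (hN : ∀ x ∈ frontier S, ∃ ν, IsOuterNormalAt S x ν) {x₀ ν : Euc n}
    (hx₀S : x₀ ∈ frontier S)
    (hx₀ : IsOuterNormalAt S x₀ ν) {L : Euc d →ₗᵢ[ℝ] Euc n} {f : Euc d → ℝ} {τ ε₀ : ℝ}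
    (hτ : 0 < τ) (hε₀ : 0 < ε₀) (hL : ∀ v, ⟪L v, ν⟫ = 0) (hf : ContDiffOn ℝ 2 f (ball 0 τ))
    (hf0 : f 0 = 0) (hf1 : fderiv ℝ f 0 = 0)
    (hgr : frontier S ∩ ball x₀ ε₀
      = {y | ∃ v ∈ ball (0 : Euc d) τ, y = x₀ + L v - f v • ν} ∩ ball x₀ ε₀)
    {k : ℝ} (hk0 : 0 < k) (hk : k = (Matrix.of fun i j : Fin d =>
      iteratedFDeriv ℝ 2 f 0 ![EuclideanSpace.single i 1, EuclideanSpace.single j 1]).det) :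
    ∃ B : Euc d →ₗ[ℝ] Euc d, B.IsSymmetric ∧ (2 * ⟪x₀, ν⟫) ^ d * LinearMap.det B ^ 2 = k ∧
      HasLocalModel S x₀ ν L B := by
  obtain ⟨ρ, hρ, hρτ, hXS, hcon⟩ :=
    exists_radius_graph_contact hdn hS hN hx₀ hτ hε₀ hL hf hf0 hf1 hgr
  have hν := hx₀.1
  have ha := hx₀.inner_pos hS
  set a := ⟪x₀, ν⟫ with hadef
  have hfa : ∀ v ∈ ball (0 : Euc d) τ, ContDiffAt ℝ 2 f v := fun v hv =>
    (hf v hv).contDiffAt (isOpen_ball.mem_nhds hv)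
  have h0τ : (0 : Euc d) ∈ ball (0 : Euc d) τ := by simpa using hτ
  set H := fderiv ℝ (fderiv ℝ f) 0 with hH
  have hsymm : ∀ v w, H v w = H w v := (hfa 0 h0τ).isSymmSndFDerivAt (by simp)
  have hfnn : ∀ v ∈ ball (0 : Euc d) ρ, 0 ≤ f v := by
    intro v hv
    have := hx₀.2 _ (hXS v hv)
    rw [inner_sub_left, inner_add_left, hL, inner_smul_left, real_inner_self_eq_norm_sq, hν] at this
    simp only [conj_trivial] at this
    linarith
  have hHpos : ∀ v, 0 ≤ H v v := by
    intro v
    by_contra! hneg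
    have hv0 : 0 < ‖v‖ := norm_pos_iff.2 (by rintro rfl; simp at hneg)
    obtain ⟨r, hr, -, hT⟩ := exists_second_order_taylor hτ hf
      (ε := -(H v v) / (4 * ‖v‖ ^ 2)) (by apply div_pos <;> [linarith; positivity])
    set t := min r ρ / (2 * ‖v‖) with ht
    have hm : 0 < min r ρ := lt_min hr hρ
    have ht0 : 0 < t := by positivity
    have htv : ‖t • v‖ < min r ρ := by
      rw [norm_smul, Real.norm_eq_abs, abs_of_pos ht0, ht]
      field_simp; linarith
    have h1 := hT 0 (by simpa using hr) (t • v)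
      (by simpa using htv.trans_le (min_le_left _ _))
    have h2 := hfnn (t • v) (by simpa using htv.trans_le (min_le_right _ _))
    rw [hf0, hf1] at h1
    simp only [sub_zero, _root_.zero_apply, map_smul, _root_.smul_apply, smul_eq_mul, norm_smul,
      Real.norm_eq_abs, mul_pow, sq_abs] at h1
    have h3 := (abs_le.1 h1).2
    have h4 : -(H v v) / (4 * ‖v‖ ^ 2) * (t ^ 2 * ‖v‖ ^ 2) = -(H v v) / 4 * t ^ 2 := by
      field_simp
    rw [h4] at h3
    nlinarith [mul_pos ht0 ht0]
  obtain ⟨B, hBs, hBn, hBd⟩ := exists_isSymmetric_sqrt_of_bilinear ((1 / (2 * a)) • H)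
    (fun v w => by simp [hsymm v w]) (fun v => by
      simp only [_root_.smul_apply, smul_eq_mul]
      exact mul_nonneg (by positivity) (hHpos v))
  have hdet : (2 * a) ^ d * LinearMap.det B ^ 2 = k := by
    have : (Matrix.of fun i j : Fin d => ((1 / (2 * a)) • H)
        (EuclideanSpace.single i 1) (EuclideanSpace.single j 1)) =
        (1 / (2 * a)) • (Matrix.of fun i j : Fin d =>
      iteratedFDeriv ℝ 2 f 0 ![EuclideanSpace.single i 1, EuclideanSpace.single j 1]) := by
      ext i j
      simp [iteratedFDeriv_two_apply, hH]
    rw [hBd, this, Matrix.det_smul, ← hk, Fintype.card_fin, one_div, inv_pow]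
    field_simp
  have hHB : ∀ v, H v v / 2 = a * ‖B v‖ ^ 2 := by
    intro v
    rw [hBn]
    simp only [_root_.smul_apply, smul_eq_mul]
    field_simp
  have hBinj : LinearMap.ker B = ⊥ := by
    by_contra h
    have h0 : LinearMap.det B = 0 := by
      by_contra h1
      exact h (LinearMap.ker_eq_bot.2
        (LinearEquiv.ofIsUnitDet (v := PiLp.basisFun 2 ℝ (Fin d)) (v' := PiLp.basisFun 2 ℝ (Fin d))
          (f := B) (by rw [LinearMap.det_toMatrix]; exact isUnit_iff_ne_zero.2 h1)).injective)
    rw [h0] at hdet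
    simp at hdet
    exact hk0.ne hdet
  obtain ⟨K, hK0, hK⟩ := B.exists_antilipschitzWith hBinj
  have hKB : ∀ w, ‖w‖ ≤ K * ‖B w‖ := fun w => by simpa using hK.le_mul_dist w 0
  refine ⟨B, hBs, hdet, ?_⟩
  set F : Euc d → ℝ := fun v => fderiv ℝ f v (isometryAdjoint L x₀ + v) + (a - f v) with hF
  have hfc : ContinuousAt f 0 := (hfa 0 h0τ).continuousAt
  have hfd : ContinuousAt (fderiv ℝ f) 0 :=
    ((hfa 0 h0τ).fderiv_right (m := 1) (by norm_num)).continuousAt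
  have hFc : ContinuousAt F 0 := by fun_prop
  have hF0 : F 0 = a := by simp [hF, hf1, hf0]
  have hFi : Tendsto (fun v => (F v)⁻¹) (𝓝 0) (𝓝 a⁻¹) := by
    have := hFc.inv₀ (by rw [hF0]; exact ha.ne')
    rw [ContinuousAt, Pi.inv_apply, hF0] at this
    exact this
  have hgraph : ∀ x y, IsContactPair S x y → ‖x - x₀‖ < ε₀ →
      x = x₀ + L (isometryAdjoint L (x - x₀)) - f (isometryAdjoint L (x - x₀)) • ν := by
    intro x y hc hx
    have : x ∈ frontier S ∩ ball x₀ ε₀ := ⟨hc.mem_frontier, by rwa [mem_ball_iff_norm]⟩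
    rw [hgr] at this
    obtain ⟨⟨v, -, hv⟩, -⟩ := this
    have : isometryAdjoint L (x - x₀) = v := by
      rw [hv, show x₀ + L v - f v • ν - x₀ = L v - f v • ν by abel, map_sub, map_smul,
        isometryAdjoint_normal L hL, isometryAdjoint_apply_self]
      simp
    rw [this]; exact hv
  have hnear : ∀ ε > 0, ∃ r > 0, ∀ x y, IsContactPair S x y → ‖x - x₀‖ < r →
      ‖y - a⁻¹ • ν‖ ≤ ε := by
    intro ε hε
    have e1 : Tendsto (fun v => ‖fderiv ℝ f v‖ * (F v)⁻¹ + |(F v)⁻¹ - a⁻¹|) (𝓝 0) (𝓝 0) := by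
      have h1 : Tendsto (fun v => ‖fderiv ℝ f v‖) (𝓝 0) (𝓝 0) := by
        have := hfd.norm
        rwa [ContinuousAt, hf1, norm_zero] at this
      have := (h1.mul hFi).add ((hFi.sub_const a⁻¹).abs)
      simpa using this
    obtain ⟨r, hr, h⟩ := Metric.eventually_nhds_iff_ball.1 (e1.eventually (gt_mem_nhds hε))
    refine ⟨min r (min ρ ε₀), lt_min hr (lt_min hρ hε₀), fun x y hc hx => ?_⟩
    simp only [lt_min_iff] at hx
    set v := isometryAdjoint L (x - x₀) with hv
    have hvn : ‖v‖ ≤ ‖x - x₀‖ := norm_isometryAdjoint_le L _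
    have hxg := hgraph x y hc hx.2.2
    rw [← hv] at hxg
    rw [hxg] at hc
    obtain ⟨hb, hbF, hder, -⟩ := hcon v (by simpa using hvn.trans_lt hx.2.1) y hc
    have hbeq : ⟪ν, y⟫ = (F v)⁻¹ := eq_inv_of_mul_eq_one_left hbF
    have hLy : ‖isometryAdjoint L y‖ ≤ ‖fderiv ℝ f v‖ * (F v)⁻¹ := by
      rw [← hbeq]
      by_contra! hlt
      have hpos : 0 < ‖isometryAdjoint L y‖ := lt_of_le_of_lt (by positivity) hlt
      have h2 : ‖isometryAdjoint L y‖ ^ 2 ≤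
          ‖fderiv ℝ f v‖ * ‖isometryAdjoint L y‖ * ⟪ν, y⟫ := by
        rw [← real_inner_self_eq_norm_sq, inner_isometryAdjoint, real_inner_comm, hder]
        gcongr
        exact (Real.le_norm_self _).trans (ContinuousLinearMap.le_opNorm _ _)
      nlinarith
    have h3 : y - a⁻¹ • ν = L (isometryAdjoint L y) + (⟪ν, y⟫ - a⁻¹) • ν := by
      conv_lhs => rw [eq_isometryAdjoint_add_normal hdn L hν hL y]
      module
    calc ‖y - a⁻¹ • ν‖ ≤ ‖L (isometryAdjoint L y)‖ + ‖(⟪ν, y⟫ - a⁻¹) • ν‖ := by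
          rw [h3]; exact norm_add_le _ _
      _ ≤ ‖fderiv ℝ f v‖ * (F v)⁻¹ + |(F v)⁻¹ - a⁻¹| := by
          rw [L.norm_map, norm_smul, hν, hbeq, Real.norm_eq_abs, mul_one]
          gcongr
      _ ≤ ε := (h v (by simpa using hvn.trans_lt hx.1)).le
  have hquad : ∀ ε > 0, ∃ r > 0, r ≤ ρ ∧ ∀ v ∈ ball (0 : Euc d) r, ∀ v' ∈ ball (0 : Euc d) r,
      |(F v)⁻¹ * (f v' - f v - fderiv ℝ f v (v' - v)) - ‖B (v' - v)‖ ^ 2| ≤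
        ε * ‖B (v' - v)‖ ^ 2 := by
    intro ε hε
    have hK0' : (0 : ℝ) < K := by exact_mod_cast hK0
    obtain ⟨r₁, hr₁, -, hT⟩ := exists_second_order_taylor hτ hf
      (ε := ε * a / (4 * K ^ 2)) (by positivity)
    have e1 : Tendsto (fun v => |(F v)⁻¹ * a - 1|) (𝓝 0) (𝓝 0) := by
      have := ((hFi.mul_const a).sub_const 1).abs
      rwa [inv_mul_cancel₀ ha.ne', sub_self, abs_zero] at this
    have e2 : ∀ᶠ v in 𝓝 0, (F v)⁻¹ < 2 * a⁻¹ :=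
      hFi.eventually (gt_mem_nhds (by linarith [inv_pos.2 ha]))
    have e3 : ∀ᶠ v in 𝓝 0, 0 < (F v)⁻¹ := hFi.eventually (lt_mem_nhds (inv_pos.2 ha))
    obtain ⟨r₂, hr₂, h⟩ := Metric.eventually_nhds_iff_ball.1
      (((e1.eventually (gt_mem_nhds (half_pos hε))).and e2).and e3)
    refine ⟨min ρ (min r₁ r₂), lt_min hρ (lt_min hr₁ hr₂), min_le_left _ _,
      fun v hv v' hv' => ?_⟩
    simp only [mem_ball_zero_iff, lt_min_iff] at hv hv'
    obtain ⟨⟨h1, h2⟩, h3⟩ := h v (by simpa using hv.2.2)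
    have h4 := hT v (by simpa using hv.2.1) v' (by simpa using hv'.2.1)
    rw [hHB] at h4
    set q := f v' - f v - fderiv ℝ f v (v' - v) with hq
    set N := ‖B (v' - v)‖ ^ 2 with hNd
    have h5 : ‖v' - v‖ ^ 2 ≤ K ^ 2 * N := by
      rw [hNd, ← mul_pow]
      exact pow_le_pow_left₀ (norm_nonneg _) (hKB _) 2
    have hN0 : 0 ≤ N := by positivity
    have h6 : |q - a * N| ≤ ε * a / 4 * N := by
      refine h4.trans ?_
      calc ε * a / (4 * K ^ 2) * ‖v' - v‖ ^ 2 ≤ ε * a / (4 * K ^ 2) * (K ^ 2 * N) := by gcongr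
        _ = ε * a / 4 * N := by field_simp
    calc |(F v)⁻¹ * q - N| = |(F v)⁻¹ * (q - a * N) + ((F v)⁻¹ * a - 1) * N| := by
          congr 1; ring
      _ ≤ |(F v)⁻¹ * (q - a * N)| + |((F v)⁻¹ * a - 1) * N| := abs_add_le _ _
      _ = (F v)⁻¹ * |q - a * N| + |(F v)⁻¹ * a - 1| * N := by
          rw [abs_mul, abs_mul, abs_of_pos h3, abs_of_nonneg hN0]
      _ ≤ (2 * a⁻¹) * (ε * a / 4 * N) + ε / 2 * N := by gcongr
      _ = ε * N := by field_simp; ring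
  intro ε hε
  obtain ⟨r₁, hr₁, hr₁ρ, hq⟩ := hquad (min ε (1 / 2)) (by positivity)
  have hloc : ∀ x y, IsContactPair S x y → ‖x - x₀‖ < min r₁ ε₀ → ∀ x' ∈ S,
      ‖isometryAdjoint L (x' - x₀)‖ < r₁ →
      (1 - min ε (1 / 2)) * ‖B (isometryAdjoint L (x' - x))‖ ^ 2 ≤ 1 - ⟪x', y⟫ := by
    intro x y hc hx x' hx' hx'r
    rw [lt_min_iff] at hx
    set v := isometryAdjoint L (x - x₀) with hv
    have hvn : ‖v‖ ≤ ‖x - x₀‖ := norm_isometryAdjoint_le L _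
    have hvr : v ∈ ball (0 : Euc d) r₁ := by simpa using hvn.trans_lt hx.1
    have hxg := hgraph x y hc hx.2
    rw [← hv] at hxg
    rw [hxg] at hc
    obtain ⟨hb, hbF, -, -, hle⟩ := hcon v (ball_subset_ball hr₁ρ hvr) y hc
    have hbeq : ⟪ν, y⟫ = (F v)⁻¹ := eq_inv_of_mul_eq_one_left hbF
    have h1 := hle x' hx' (ball_subset_ball hr₁ρ (by simpa using hx'r))
    have h2 := hq v hvr (isometryAdjoint L (x' - x₀)) (by simpa using hx'r)
    have h3 : isometryAdjoint L (x' - x) = isometryAdjoint L (x' - x₀) - v := by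
      rw [hv, ← map_sub]; congr 1; abel
    rw [h3]
    rw [hbeq] at h1
    linarith [(abs_le.1 h2).1]
  have hc0 := hx₀.isContactPair hS hx₀S
  have hface : ∀ x' ∈ S, r₁ ≤ ‖isometryAdjoint L (x' - x₀)‖ → 0 < 1 - ⟪x', a⁻¹ • ν⟫ := by
    intro x' hx' hr'
    have hle := hc0.2.1 x' hx'
    rcases hle.lt_or_eq with h | h
    · linarith
    exfalso
    set w := isometryAdjoint L (x' - x₀) with hw
    have hw0 : 0 < ‖w‖ := hr₁.trans_le hr'
    set t := r₁ / (2 * ‖w‖) with ht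
    have ht0 : 0 < t := by positivity
    have ht1 : t ≤ 1 := by rw [ht, div_le_one (by positivity)]; linarith
    have hxt : x₀ + t • (x' - x₀) ∈ S := by
      have := hS.2.1 hc0.1 hx' (sub_nonneg.2 ht1) ht0.le (by ring)
      convert this using 1
      module
    have hLt : isometryAdjoint L (x₀ + t • (x' - x₀) - x₀) = t • w := by
      rw [add_sub_cancel_left, map_smul]
    have h1 := hloc x₀ _ hc0 (by simp [hr₁, hε₀]) _ hxt (by
      rw [hLt, norm_smul, Real.norm_eq_abs, abs_of_pos ht0, ht]
      field_simp; linarith)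
    rw [hLt, inner_add_left, inner_smul_left, inner_sub_left, hc0.2.2, h, sub_self, mul_zero,
      add_zero, sub_self, map_smul, norm_smul] at h1
    have h2 : 0 < ‖B w‖ := by
      by_contra! hB
      have := hKB w
      have : (K : ℝ) * ‖B w‖ ≤ 0 := mul_nonpos_of_nonneg_of_nonpos K.2 hB
      linarith
    have h3 : min ε (1 / 2) ≤ 1 / 2 := min_le_right _ _
    have h4 : 0 < (1 - min ε (1 / 2)) * (‖t‖ * ‖B w‖) ^ 2 := by
      have : 0 < ‖t‖ := by rw [Real.norm_eq_abs, abs_of_pos ht0]; exact ht0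
      apply mul_pos (by linarith) (by positivity)
    linarith
  obtain ⟨c, hc, hcS⟩ : ∃ c > 0, ∀ x' ∈ S, r₁ ≤ ‖isometryAdjoint L (x' - x₀)‖ →
      2 * c ≤ 1 - ⟪x', a⁻¹ • ν⟫ := by
    have hcl : IsClosed {x' : Euc n | r₁ ≤ ‖isometryAdjoint L (x' - x₀)‖} :=
      isClosed_le continuous_const (by fun_prop)
    have hcomp := hS.1.inter_right hcl
    rcases (S ∩ {x' | r₁ ≤ ‖isometryAdjoint L (x' - x₀)‖}).eq_empty_or_nonempty with he | hne
    · exact ⟨1, one_pos, fun x' h1 h2 => (he.subset ⟨h1, h2⟩).elim⟩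
    · obtain ⟨z, hz, hmin⟩ := hcomp.exists_isMinOn hne
        (f := fun x' => 1 - ⟪x', a⁻¹ • ν⟫) (by fun_prop)
      refine ⟨(1 - ⟪z, a⁻¹ • ν⟫) / 2, half_pos (hface z hz.1 hz.2), fun x' h1 h2 => ?_⟩
      have : 1 - ⟪z, a⁻¹ • ν⟫ ≤ 1 - ⟪x', a⁻¹ • ν⟫ := hmin ⟨h1, h2⟩
      linarith
  obtain ⟨R, hR0, hR⟩ := hS.1.isBounded.subset_closedBall_lt 0 0
  obtain ⟨r₂, hr₂, hn2⟩ := hnear (min ε (c / R)) (lt_min hε (div_pos hc hR0))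
  refine ⟨min r₂ (min (r₁ / 2) ε₀), lt_min hr₂ (lt_min (half_pos hr₁) hε₀), c, hc,
    fun x y hcp hx => ?_⟩
  simp only [lt_min_iff] at hx
  refine ⟨(hn2 x y hcp hx.1).trans (min_le_left _ _), fun w hw => ?_, fun x' hx' hlt => ?_⟩
  · simp only [lt_min_iff] at hw
    set v := isometryAdjoint L (x - x₀) with hv
    have hvn : ‖v‖ ≤ ‖x - x₀‖ := norm_isometryAdjoint_le L _
    have hvr : v ∈ ball (0 : Euc d) r₁ := by
      rw [mem_ball_zero_iff]; linarith [hvn.trans_lt hx.2.1]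
    have hxg := hgraph x y hcp hx.2.2
    rw [← hv] at hxg
    have hcp' := hcp
    rw [hxg] at hcp'
    obtain ⟨hb, hbF, -, hval, -⟩ := hcon v (ball_subset_ball hr₁ρ hvr) y hcp'
    have hbeq : ⟪ν, y⟫ = (F v)⁻¹ := eq_inv_of_mul_eq_one_left hbF
    have hwr : v + w ∈ ball (0 : Euc d) r₁ := by
      rw [mem_ball_zero_iff]; linarith [hvn.trans_lt hx.2.1, norm_add_le v w, hw.2.1]
    refine ⟨_, hXS (v + w) (ball_subset_ball hr₁ρ hwr), ?_, ?_⟩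
    · conv_lhs => rw [hxg]
      rw [show x₀ + L (v + w) - f (v + w) • ν - (x₀ + L v - f v • ν) =
        L (v + w) - L v - (f (v + w) - f v) • ν by module, map_sub, map_smul,
        isometryAdjoint_normal L hL, ← map_sub, isometryAdjoint_apply_self]
      simp
    · have h1 := hq v hvr _ hwr
      rw [hval _ (ball_subset_ball hr₁ρ hwr), hbeq]
      rw [add_sub_cancel_left] at h1 ⊢
      refine h1.trans ?_
      gcongr
      exact min_le_left _ _
  · have hsm : ‖isometryAdjoint L (x' - x₀)‖ < r₁ := by
      by_contra! h
      have h1 := hcS x' hx' h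
      have h2 : |⟪x', y - a⁻¹ • ν⟫| ≤ R * (c / R) := by
        refine (abs_real_inner_le_norm _ _).trans ?_
        have : ‖x'‖ ≤ R := by simpa using hR hx'
        gcongr
        exact (hn2 x y hcp hx.1).trans (min_le_right _ _)
      rw [mul_div_cancel₀ _ hR0.ne', inner_sub_right] at h2
      linarith [(abs_le.1 h2).2]
    have := hloc x y hcp (lt_min (by linarith [hx.2.1]) hx.2.2) x' hx' hsm
    refine le_trans ?_ this
    gcongr
    exact min_le_left _ _

/-- The rescaled cap determined by a set `W` of (tangential displacement, height) pairs. -/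
def scaledCap {d : ℕ} (W : Set (Euc d × ℝ)) (h : ℝ) (m : Euc d × ℝ → ℝ) : Set (Euc d × ℝ) :=
  {p | (∃ w ∈ W, 0 < p.2 + 2 * ⟪w.1, p.1⟫ - m p * w.2) ∧
    ∀ w ∈ W, 1 ≤ (1 + h) * w.2 → p.2 + 2 * ⟪w.1, p.1⟫ - m p * w.2 ≤ 0}

/-- The region between a paraboloid and a tangent cone. -/
def limitCap (d : ℕ) : Set (Euc d × ℝ) :=
  regionBetween (fun ξ => -‖ξ‖ ^ 2) (fun ξ => 1 - 2 * ‖ξ‖) (ball 0 1)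

theorem mem_limitCap_iff {d : ℕ} (p : Euc d × ℝ) :
    p ∈ limitCap d ↔ ‖p.1‖ < 1 ∧ -‖p.1‖ ^ 2 < p.2 ∧ p.2 < 1 - 2 * ‖p.1‖ := by
  simp [limitCap, regionBetween]

theorem measurableSet_limitCap (d : ℕ) : MeasurableSet (limitCap d) :=
  measurableSet_regionBetween (by fun_prop) (by fun_prop) measurableSet_ball

theorem volume_limitCap {d : ℕ} (hd : 1 ≤ d) :
    volume (limitCap d) = ENNReal.ofReal
      (2 * (volume (ball (0 : Euc d) 1)).toReal / ((d + 1) * (d + 2))) := by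
  have hnt : Nontrivial (Euc d) := by
    have : Nonempty (Fin d) := ⟨⟨0, hd⟩⟩
    infer_instance
  have hgi : ∀ g : Euc d → ℝ, Continuous g → IntegrableOn g (ball 0 1) := fun g hg =>
    (hg.continuousOn.integrableOn_compact (isCompact_closedBall 0 1)).mono_set
      ball_subset_closedBall
  rw [limitCap, Measure.volume_eq_prod, volume_regionBetween_eq_integral
    (hgi _ (by fun_prop)) (hgi _ (by fun_prop)) measurableSet_ball
    (fun x _ => by nlinarith [sq_nonneg (‖x‖ - 1)])]
  congr 1
  have h1 : ∫ y in ball (0 : Euc d) 1,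
      ((fun ξ : Euc d => 1 - 2 * ‖ξ‖) - (fun ξ => -‖ξ‖ ^ 2) : Euc d → ℝ) y =
      ∫ y : Euc d, (Iio (1 : ℝ)).indicator (fun r => (1 - r) ^ 2) ‖y‖ := by
    rw [← integral_indicator measurableSet_ball]
    congr 1
    ext y
    by_cases hy : ‖y‖ < 1
    · rw [indicator_of_mem (by simpa using hy), indicator_of_mem (by simpa using hy)]
      simp only [Pi.sub_apply]; ring
    · rw [indicator_of_notMem (by simpa using hy), indicator_of_notMem (by simpa using hy)]
  rw [h1, integral_fun_norm_addHaar]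
  have h2 : ∫ y in Ioi (0 : ℝ), y ^ (Module.finrank ℝ (Euc d) - 1) •
      (Iio (1 : ℝ)).indicator (fun r => (1 - r) ^ 2) y =
      ∫ y in (0 : ℝ)..1, y ^ (d - 1) * (1 - y) ^ 2 := by
    rw [intervalIntegral.integral_of_le zero_le_one, integral_Ioc_eq_integral_Ioo,
      ← Ioi_inter_Iio, ← setIntegral_indicator measurableSet_Iio, finrank_euclideanSpace_fin]
    congr 1
    ext y
    simp only [indicator, smul_eq_mul, mul_ite, mul_zero]
  rw [h2]
  obtain ⟨k, rfl⟩ : ∃ k, d = k + 1 := ⟨d - 1, by omega⟩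
  have h3 : ∫ y in (0 : ℝ)..1, y ^ (k + 1 - 1) * (1 - y) ^ 2 =
      1 / ((k : ℝ) + 1) - 2 / ((k : ℝ) + 2) + 1 / ((k : ℝ) + 3) := by
    have : ∀ y : ℝ, y ^ (k + 1 - 1) * (1 - y) ^ 2 = y ^ k - 2 * y ^ (k + 1) + y ^ (k + 2) := by
      intro y; simp only [Nat.add_sub_cancel]; ring
    simp_rw [this]
    rw [intervalIntegral.integral_add, intervalIntegral.integral_sub,
      intervalIntegral.integral_const_mul, integral_pow, integral_pow, integral_pow]
    · push_cast; simp; ring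
    all_goals exact Continuous.intervalIntegrable (by fun_prop) _ _
  rw [h3, finrank_euclideanSpace_fin]
  simp only [Measure.real, nsmul_eq_mul, smul_eq_mul]
  push_cast
  field_simp
  ring

theorem ae_ne_graph {d : ℕ} {g : Euc d → ℝ} (hg : Continuous g) :
    ∀ᵐ p : Euc d × ℝ, p.2 ≠ g p.1 := by
  rw [ae_iff]
  simp only [not_not]
  rw [Measure.volume_eq_prod, Measure.measure_prod_null]
  · refine Eventually.of_forall fun x => ?_
    have : Prod.mk x ⁻¹' {a : Euc d × ℝ | a.2 = g a.1} = {g x} := by ext; simp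
    simp only [this]; simp
  · exact (isClosed_eq continuous_snd (hg.comp continuous_fst)).measurableSet

section scaledCapLimit

variable {d : ℕ} {W : ℕ → Set (Euc d × ℝ)} {h : ℕ → ℝ} {m : ℕ → Euc d × ℝ → ℝ}

theorem exists_bound_of_scaledCap_witness
    (hq : ∀ k, ∀ w ∈ W k, 0 ≤ w.2)
    (hB : ∃ C > 0, ∀ᶠ k in atTop, ∀ w ∈ W k, ‖w.1‖ ^ 2 ≤ C * w.2)
    {p : Euc d × ℝ} (hm : Tendsto (fun k => m k p) atTop (𝓝 1)) :
    ∃ R > 0, ∀ᶠ k in atTop, ∀ w ∈ W k, 0 < p.2 + 2 * ⟪w.1, p.1⟫ - m k p * w.2 → w.2 ≤ R := by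
  obtain ⟨C, hC, hB⟩ := hB
  refine ⟨2 * |p.2| + 4 * ((4 * C * ‖p.1‖ + 2 * C * |p.2| + 1) * ‖p.1‖) + 1, by positivity, ?_⟩
  filter_upwards [hB, hm.eventually (lt_mem_nhds (by norm_num : (1 / 2 : ℝ) < 1))]
    with k hk hmk w hw h0
  have hw0 := hq k w hw
  have h1 := hk w hw
  have h2 : ⟪w.1, p.1⟫ ≤ ‖w.1‖ * ‖p.1‖ := real_inner_le_norm _ _
  have h3 : w.2 ≤ 2 * |p.2| + 4 * (‖w.1‖ * ‖p.1‖) := by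
    nlinarith [le_abs_self p.2]
  have h4 : ‖w.1‖ ≤ 4 * C * ‖p.1‖ + 2 * C * |p.2| + 1 := by
    by_contra! hlt
    have h5 : ‖w.1‖ ^ 2 ≤ C * (2 * |p.2| + 4 * (‖w.1‖ * ‖p.1‖)) := h1.trans (by gcongr)
    have h6 : 0 ≤ C * |p.2| := by positivity
    have h7 : 0 ≤ C * ‖p.1‖ := by positivity
    nlinarith [norm_nonneg w.1]
  have h5 : ‖w.1‖ * ‖p.1‖ ≤ (4 * C * ‖p.1‖ + 2 * C * |p.2| + 1) * ‖p.1‖ := by gcongr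
  linarith

theorem eventually_mem_scaledCap_iff (hd : 1 ≤ d)
    (hh : Tendsto h atTop (𝓝[>] 0))
    (hq : ∀ k, ∀ w ∈ W k, 0 ≤ w.2)
    (ha : ∀ R ε : ℝ, 0 < ε → ∀ᶠ k in atTop, ∀ ω : Euc d, ‖ω‖ ≤ R →
      ∃ q, (ω, q) ∈ W k ∧ |q - ‖ω‖ ^ 2| ≤ ε)
    (hB : ∃ C > 0, ∀ᶠ k in atTop, ∀ w ∈ W k, ‖w.1‖ ^ 2 ≤ C * w.2)
    (hBC : ∀ R ε : ℝ, 0 < ε → ∀ᶠ k in atTop, ∀ w ∈ W k, w.2 ≤ R → ‖w.1‖ ^ 2 ≤ w.2 + ε)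
    {p : Euc d × ℝ} (hm : Tendsto (fun k => m k p) atTop (𝓝 1))
    (h1 : p.2 ≠ -‖p.1‖ ^ 2) (h2 : p.2 ≠ 1 - 2 * ‖p.1‖) :
    ∀ᶠ k in atTop, p ∈ scaledCap (W k) (h k) (m k) ↔ p ∈ limitCap d := by
  obtain ⟨hh0, hhpos⟩ := tendsto_nhdsWithin_iff.1 hh
  obtain ⟨ξ, s⟩ := p
  simp only at h1 h2
  obtain ⟨R, hR, hRb⟩ := exists_bound_of_scaledCap_witness hq hB hm
  have hmR : ∀ (R : ℝ) (ε : ℝ), 0 < ε → ∀ᶠ k in atTop, |m k (ξ, s) - 1| * R ≤ ε := by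
    intro R ε hε
    have : Tendsto (fun k => |m k (ξ, s) - 1| * R) atTop (𝓝 0) := by
      have := ((hm.sub_const 1).abs).mul_const R
      simpa using this
    exact (this.eventually (gt_mem_nhds hε)).mono fun k hk => hk.le
  have wit : ∀ ω : Euc d, 0 < s + 2 * ⟪ω, ξ⟫ - ‖ω‖ ^ 2 → ∀ ε > 0, ∀ᶠ k in atTop,
      ∃ q, (ω, q) ∈ W k ∧ |q - ‖ω‖ ^ 2| ≤ ε ∧ 0 < s + 2 * ⟪ω, ξ⟫ - m k (ξ, s) * q := by
    intro ω hω ε hε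
    set D := s + 2 * ⟪ω, ξ⟫ - ‖ω‖ ^ 2 with hD
    filter_upwards [ha ‖ω‖ (min ε (D / 3)) (by positivity), hmR (‖ω‖ ^ 2 + D / 3) (D / 3)
      (by positivity)] with k h1 h2
    obtain ⟨q, hqW, hqa⟩ := h1 ω le_rfl
    refine ⟨q, hqW, hqa.trans (min_le_left _ _), ?_⟩
    have h3 := (abs_le.1 (hqa.trans (min_le_right _ _))).2
    have hq0 : 0 ≤ q := hq k _ hqW
    have h4 : (m k (ξ, s) - 1) * q ≤ |m k (ξ, s) - 1| * (‖ω‖ ^ 2 + D / 3) :=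
      mul_le_mul (le_abs_self _) (by linarith) hq0 (abs_nonneg _)
    linarith
  rcases lt_or_gt_of_ne h1 with hlt | hgt
  · have hε : 0 < -(s + ‖ξ‖ ^ 2) / 3 := by linarith
    filter_upwards [hRb, hBC R _ hε, hmR R _ hε] with k k1 k2 k3
    refine iff_of_false ?_ fun hmem => by
      have := ((mem_limitCap_iff _).1 hmem).2.1
      simp only at this
      linarith
    rintro ⟨⟨w, hw, h0⟩, -⟩
    have hwR := k1 w hw h0
    have := k2 w hw hwR
    have hw0 := hq k w hw
    have h4 : -(m k (ξ, s) - 1) * w.2 ≤ |m k (ξ, s) - 1| * R :=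
      mul_le_mul (neg_le_abs _) hwR hw0 (abs_nonneg _)
    have h5 := norm_sub_sq_real w.1 ξ
    simp only at h0
    nlinarith [sq_nonneg ‖w.1 - ξ‖]
  by_cases hin : ‖ξ‖ < 1 ∧ s < 1 - 2 * ‖ξ‖
  · obtain ⟨hξ, hs⟩ := hin
    have hε : 0 < (1 - 2 * ‖ξ‖ - s) / 4 := by linarith
    filter_upwards [hRb, hBC R _ hε, hmR R _ hε,
      wit ξ (by rw [real_inner_self_eq_norm_sq]; linarith) 1 one_pos,
      hh0.eventually (gt_mem_nhds hε), hhpos] with k k1 k2 k3 k4 k5 k6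
    refine iff_of_true ⟨?_, ?_⟩ ((mem_limitCap_iff _).2 ⟨hξ, hgt, hs⟩)
    · obtain ⟨q, h3, -, h4⟩ := k4
      exact ⟨_, h3, h4⟩
    · intro w hw hw1
      by_contra! h0
      have hwR := k1 w hw h0
      have h3 := k2 w hw hwR
      have hw0 := hq k w hw
      simp only [mem_Ioi] at k6
      have h4 : -(m k (ξ, s) - 1) * w.2 ≤ |m k (ξ, s) - 1| * R :=
        mul_le_mul (neg_le_abs _) hwR hw0 (abs_nonneg _)
      set ε := (1 - 2 * ‖ξ‖ - s) / 4 with hεd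
      set r := √(w.2 + ε) with hr
      have hr2 : r ^ 2 = w.2 + ε := Real.sq_sqrt (by linarith)
      have hr1 : 1 ≤ r := by
        rw [hr, Real.one_le_sqrt]
        by_contra! hlt
        nlinarith
      have hwr : ‖w.1‖ ≤ r := Real.le_sqrt_of_sq_le h3
      have h5 : ⟪w.1, ξ⟫ ≤ r * ‖ξ‖ := (real_inner_le_norm _ _).trans (by gcongr)
      simp only at h0
      have h6 : (r - 1) * (2 * ‖ξ‖ - (r + 1)) ≤ 0 :=
        mul_nonpos_of_nonneg_of_nonpos (by linarith) (by linarith)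
      nlinarith
  · have hex : ∃ ω : Euc d, 1 < ‖ω‖ ∧ 0 < s + 2 * ⟪ω, ξ⟫ - ‖ω‖ ^ 2 := by
      obtain ⟨e, he, heξ⟩ : ∃ e : Euc d, ‖e‖ = 1 ∧ ⟪e, ξ⟫ = ‖ξ‖ := by
        by_cases hξ : ξ = 0
        · refine ⟨EuclideanSpace.single ⟨0, hd⟩ 1, by simp, by simp [hξ]⟩
        · have hn : 0 < ‖ξ‖ := norm_pos_iff.2 hξ
          refine ⟨‖ξ‖⁻¹ • ξ, by rw [norm_smul, norm_inv, norm_norm, inv_mul_cancel₀ hn.ne'], ?_⟩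
          rw [inner_smul_left, real_inner_self_eq_norm_sq]
          simp only [conj_trivial]
          field_simp
      have key : ∃ t : ℝ, 1 < t ∧ 0 < s + 2 * (t * ‖ξ‖) - t ^ 2 := by
        rcases lt_or_ge 1 ‖ξ‖ with hξ | hξ
        · exact ⟨‖ξ‖, hξ, by nlinarith⟩
        · have hpos : 0 < s + 2 * (1 * ‖ξ‖) - 1 ^ 2 := by
            rcases hξ.lt_or_eq with h3 | h3
            · have : 1 - 2 * ‖ξ‖ ≤ s := by
                by_contra! hh
                exact hin ⟨h3, hh⟩
              have := lt_of_le_of_ne this (Ne.symm h2)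
              linarith
            · rw [h3] at hgt ⊢; linarith
          have hc : ContinuousAt (fun t : ℝ => s + 2 * (t * ‖ξ‖) - t ^ 2) 1 := by fun_prop
          have := (hc.eventually (lt_mem_nhds hpos)).filter_mono
            (nhdsWithin_le_nhds (s := Ioi (1 : ℝ)))
          obtain ⟨t, h3, h4⟩ := (this.and self_mem_nhdsWithin).exists
          exact ⟨t, h4, h3⟩
      obtain ⟨t, ht, hpos⟩ := key
      refine ⟨t • e, ?_, ?_⟩
      · rw [norm_smul, he, mul_one]; exact ht.trans_le (le_abs_self _)
      · rw [inner_smul_left, heξ, norm_smul, he, mul_one, Real.norm_eq_abs, sq_abs]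
        exact hpos
    obtain ⟨ω, hω1, hω⟩ := hex
    filter_upwards [wit ω hω (‖ω‖ ^ 2 - 1) (by nlinarith), hhpos] with k k1 k2
    refine iff_of_false ?_ fun hmem => hin ?_
    · rintro ⟨-, hall⟩
      obtain ⟨q, h3, h4, h5⟩ := k1
      have h6 := (abs_le.1 h4).1
      simp only [mem_Ioi] at k2
      have := hall _ h3 (by simp only; nlinarith)
      simp only at this
      linarith
    · obtain ⟨h3, -, h4⟩ := (mem_limitCap_iff _).1 hmem
      exact ⟨h3, h4⟩

theorem exists_scaledCap_subset_closedBall (hd : 1 ≤ d)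
    (hh : Tendsto h atTop (𝓝[>] 0))
    (hq : ∀ k, ∀ w ∈ W k, 0 ≤ w.2)
    (ha : ∀ R ε : ℝ, 0 < ε → ∀ᶠ k in atTop, ∀ ω : Euc d, ‖ω‖ ≤ R →
      ∃ q, (ω, q) ∈ W k ∧ |q - ‖ω‖ ^ 2| ≤ ε)
    (hB : ∃ C > 0, ∀ᶠ k in atTop, ∀ w ∈ W k, ‖w.1‖ ^ 2 ≤ C * w.2)
    (hm : ∃ M, ∀ᶠ k in atTop, ∀ p ∈ scaledCap (W k) (h k) (m k), |m k p| ≤ M) :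
    ∃ R, ∀ᶠ k in atTop, scaledCap (W k) (h k) (m k) ⊆ closedBall 0 R := by
  obtain ⟨C, hC, hB⟩ := hB
  obtain ⟨M, hm⟩ := hm
  obtain ⟨hh0, hhpos⟩ := tendsto_nhdsWithin_iff.1 hh
  set R := C + 3 with hRd
  set N := |M| * (R ^ 2 + 2) with hN
  have hN0 : 0 ≤ N := by positivity
  refine ⟨N + |M| + 2 * (C + 1) * N, ?_⟩
  filter_upwards [hB, hm, hhpos, ha R 1 one_pos] with k k1 k2 k3 k4
  rintro ⟨ξ, s⟩ hp
  simp only [mem_Ioi] at k3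
  have hmp := (k2 _ hp).trans (le_abs_self M)
  obtain ⟨⟨w, hw, h0⟩, hall⟩ := hp
  simp only at h0 hall
  have hw0 := hq k w hw
  have hw1 : w.2 < 1 := by
    by_contra! hge
    have := hall w hw (by nlinarith)
    linarith
  have hwn : ‖w.1‖ ≤ C + 1 := by
    have := k1 w hw
    by_contra! hlt
    nlinarith
  have h1 : ⟪w.1, ξ⟫ ≤ (C + 1) * ‖ξ‖ := (real_inner_le_norm _ _).trans (by gcongr)
  have h2 : -|M| ≤ m k (ξ, s) * w.2 := by
    have : |m k (ξ, s) * w.2| ≤ |M| * 1 := by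
      rw [abs_mul, abs_of_nonneg hw0]; gcongr
    linarith [(abs_le.1 this).1]
  have h3 : -|M| < s + 2 * ((C + 1) * ‖ξ‖) := by linarith
  obtain ⟨ω, hωn, hωξ⟩ : ∃ ω : Euc d, ‖ω‖ = R ∧ ⟪ω, ξ⟫ = R * ‖ξ‖ := by
    have hR0 : 0 < R := by positivity
    by_cases hξ : ξ = 0
    · exact ⟨EuclideanSpace.single ⟨0, hd⟩ R, by simp [abs_of_pos hR0], by simp [hξ]⟩
    · have hn : 0 < ‖ξ‖ := norm_pos_iff.2 hξ
      refine ⟨(R * ‖ξ‖⁻¹) • ξ, ?_, ?_⟩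
      · rw [norm_smul, norm_mul, norm_inv, norm_norm, Real.norm_eq_abs, abs_of_pos hR0, mul_assoc,
          inv_mul_cancel₀ hn.ne', mul_one]
      · rw [inner_smul_left, real_inner_self_eq_norm_sq]
        simp only [conj_trivial]
        field_simp
  obtain ⟨q, hqW, hqa⟩ := k4 ω hωn.le
  rw [hωn] at hqa
  have hqa' := abs_le.1 hqa
  have hq1 : 1 ≤ q := by nlinarith
  have h4 := hall _ hqW (by simp only; nlinarith)
  simp only at h4
  rw [hωξ] at h4
  have h5 : m k (ξ, s) * q ≤ |M| * (R ^ 2 + 1) :=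
    mul_le_mul ((le_abs_self _).trans hmp) (by linarith) (by linarith) (abs_nonneg _)
  have hM := abs_nonneg M
  have h6 : ‖ξ‖ ≤ N := by
    rw [hN]
    have : 4 * ‖ξ‖ ≤ |M| * (R ^ 2 + 1) + |M| := by rw [hRd] at h4 h5 ⊢; nlinarith
    nlinarith [norm_nonneg ξ]
  rw [mem_closedBall_zero_iff, Prod.norm_def, max_le_iff]
  have h7 : (C + 1) * ‖ξ‖ ≤ (C + 1) * N := by gcongr
  refine ⟨?_, ?_⟩
  · have : 0 ≤ 2 * (C + 1) * N := by positivity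
    simp only; linarith
  · simp only [Real.norm_eq_abs]
    rw [abs_le]
    have h8 : 0 ≤ R * ‖ξ‖ := by positivity
    have h9 : 0 ≤ (C + 1) * N := by positivity
    constructor
    · linarith
    · nlinarith

theorem tendsto_volume_scaledCap (hd : 1 ≤ d)
    (hh : Tendsto h atTop (𝓝[>] 0))
    (hq : ∀ k, ∀ w ∈ W k, 0 ≤ w.2)
    (ha : ∀ R ε : ℝ, 0 < ε → ∀ᶠ k in atTop, ∀ ω : Euc d, ‖ω‖ ≤ R →
      ∃ q, (ω, q) ∈ W k ∧ |q - ‖ω‖ ^ 2| ≤ ε)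
    (hB : ∃ C > 0, ∀ᶠ k in atTop, ∀ w ∈ W k, ‖w.1‖ ^ 2 ≤ C * w.2)
    (hBC : ∀ R ε : ℝ, 0 < ε → ∀ᶠ k in atTop, ∀ w ∈ W k, w.2 ≤ R → ‖w.1‖ ^ 2 ≤ w.2 + ε)
    (hm : ∃ M, ∀ᶠ k in atTop, ∀ p ∈ scaledCap (W k) (h k) (m k), |m k p| ≤ M)
    (hm1 : ∀ p, Tendsto (fun k => m k p) atTop (𝓝 1))
    (hmeas : ∀ k, MeasurableSet (scaledCap (W k) (h k) (m k))) :
    Tendsto (fun k => volume (scaledCap (W k) (h k) (m k))) atTop (𝓝 (volume (limitCap d))) := by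
  obtain ⟨R, hR⟩ := exists_scaledCap_subset_closedBall hd hh hq ha hB hm
  refine tendsto_measure_of_ae_tendsto_indicator atTop (measurableSet_limitCap d) hmeas
    (measurableSet_closedBall (x := (0 : Euc d × ℝ)) (ε := R)) measure_closedBall_lt_top.ne hR ?_
  filter_upwards [ae_ne_graph (g := fun ξ : Euc d => -‖ξ‖ ^ 2) (by fun_prop),
    ae_ne_graph (g := fun ξ : Euc d => 1 - 2 * ‖ξ‖) (by fun_prop)] with p h1 h2
  exact eventually_mem_scaledCap_iff hd hh hq ha hB hBC (hm1 p) h1 h2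

end scaledCapLimit

section CapParametrization

variable {d n : ℕ}

/-- The pairs (rescaled tangential displacement, rescaled height) of the points of `S` relative to
the contact pair `(x, y)`. -/
def heightSet (S : Set (Euc n)) (L : Euc d →ₗᵢ[ℝ] Euc n) (B : Euc d →ₗ[ℝ] Euc d) (x y : Euc n)
    (h : ℝ) : Set (Euc d × ℝ) :=
  (fun x' => ((√h)⁻¹ • B (isometryAdjoint L (x' - x)), (1 - ⟪x', y⟫) / h)) '' S

/-- The multiple of `y` in the parametrization of a neighbourhood of `y`. -/
def heightFactor (L : Euc d →ₗᵢ[ℝ] Euc n) (B : Euc d →ₗ[ℝ] Euc d) (x : Euc n) (h : ℝ)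
    (p : Euc d × ℝ) : ℝ :=
  1 + h * p.2 - √h * ⟪x, L ((2 : ℝ) • B p.1)⟫

/-- A parametrization of a neighbourhood of `y` adapted to the contact pair `(x, y)`. -/
def capParam (L : Euc d →ₗᵢ[ℝ] Euc n) (B : Euc d →ₗ[ℝ] Euc d) (x y : Euc n) (h : ℝ)
    (p : Euc d × ℝ) : Euc n :=
  heightFactor L B x h p • y + √h • L ((2 : ℝ) • B p.1)

theorem continuous_heightFactor (L : Euc d →ₗᵢ[ℝ] Euc n) (B : Euc d →ₗ[ℝ] Euc d) (x : Euc n)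
    (h : ℝ) : Continuous (heightFactor L B x h) := by
  have hB : Continuous B := B.continuous_of_finiteDimensional
  have hL := L.continuous
  unfold heightFactor
  fun_prop

theorem continuous_capParam (L : Euc d →ₗᵢ[ℝ] Euc n) (B : Euc d →ₗ[ℝ] Euc d) (x y : Euc n)
    (h : ℝ) : Continuous (capParam L B x y h) := by
  have hB : Continuous B := B.continuous_of_finiteDimensional
  have hL := L.continuous
  have := continuous_heightFactor L B x h
  unfold capParam
  fun_prop

theorem inner_capParam_sub_one {L : Euc d →ₗᵢ[ℝ] Euc n} {B : Euc d →ₗ[ℝ] Euc d}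
    (hB : B.IsSymmetric) (x y : Euc n) {h : ℝ} (hh : 0 < h) (p : Euc d × ℝ) (x' : Euc n) :
    ⟪x', capParam L B x y h p⟫ - 1 =
      h * (p.2 + 2 * ⟪(√h)⁻¹ • B (isometryAdjoint L (x' - x)), p.1⟫ -
        heightFactor L B x h p * ((1 - ⟪x', y⟫) / h)) := by
  have h1 : ⟪(√h)⁻¹ • B (isometryAdjoint L (x' - x)), p.1⟫ = (√h)⁻¹ * ⟪x' - x, L (B p.1)⟫ := by
    rw [inner_smul_left, hB, inner_isometryAdjoint]
    rfl
  have hs : √h * √h = h := Real.mul_self_sqrt hh.le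
  have hs0 : √h ≠ 0 := (Real.sqrt_pos.2 hh).ne'
  have h2 : h * (√h)⁻¹ = √h := by field_simp; rw [sq, hs]
  rw [h1, capParam, inner_add_right, inner_smul_right, inner_smul_right]
  have h3 : h * (p.2 + 2 * ((√h)⁻¹ * ⟪x' - x, L (B p.1)⟫) -
      heightFactor L B x h p * ((1 - ⟪x', y⟫) / h)) =
      h * p.2 + 2 * ((h * (√h)⁻¹) * ⟪x' - x, L (B p.1)⟫) -
      heightFactor L B x h p * (1 - ⟪x', y⟫) := by field_simp
  rw [h3, h2, heightFactor, map_smul, inner_smul_right, inner_smul_right, inner_sub_left]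
  ring

theorem preimage_capParam_polarCap {S : Set (Euc n)} (hS : IsSymConvexBody S)
    {L : Euc d →ₗᵢ[ℝ] Euc n} {B : Euc d →ₗ[ℝ] Euc d} (hB : B.IsSymmetric) (x y : Euc n) {h : ℝ}
    (hh : 0 < h) :
    capParam L B x y h ⁻¹' polarCap S ((1 + h) • y) =
      scaledCap (heightSet S L B x y h) h (heightFactor L B x h) := by
  ext p
  have key := fun x' => inner_capParam_sub_one (L := L) hB x y hh p x'
  have e1 : ∀ x', 1 < ⟪x', capParam L B x y h p⟫ ↔
      0 < p.2 + 2 * ⟪(√h)⁻¹ • B (isometryAdjoint L (x' - x)), p.1⟫ -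
        heightFactor L B x h p * ((1 - ⟪x', y⟫) / h) := fun x' => by
    rw [← sub_pos, key, mul_pos_iff_of_pos_left hh]
  have e2 : ∀ x', ⟪x', (1 + h) • y⟫ ≤ 1 ↔ 1 ≤ (1 + h) * ((1 - ⟪x', y⟫) / h) := fun x' => by
    rw [inner_smul_right, ← mul_div_assoc, le_div_iff₀ hh]
    constructor <;> intro h <;> linarith
  rw [mem_preimage, mem_polarCap_iff hS]
  simp only [scaledCap, heightSet, mem_ofPred_eq, exists_mem_image, forall_mem_image, e1, e2,
    ← not_lt]

theorem measurableSet_scaledCap_heightSet {S : Set (Euc n)} (hS : IsSymConvexBody S)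
    {L : Euc d →ₗᵢ[ℝ] Euc n} {B : Euc d →ₗ[ℝ] Euc d} (hB : B.IsSymmetric) (x y : Euc n) {h : ℝ}
    (hh : 0 < h) :
    MeasurableSet (scaledCap (heightSet S L B x y h) h (heightFactor L B x h)) := by
  rw [← preimage_capParam_polarCap hS hB x y hh]
  exact (continuous_capParam L B x y h).measurable (measurableSet_polarCap hS _)

theorem volume_polarCap_eq (hdn : d + 1 = n) {S : Set (Euc n)} (hS : IsSymConvexBody S)
    {L : Euc d →ₗᵢ[ℝ] Euc n} {ν : Euc n} (hν : ‖ν‖ = 1) (hL : ∀ v, ⟪L v, ν⟫ = 0)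
    {B : Euc d →ₗ[ℝ] Euc d} (hB : B.IsSymmetric) (hB0 : LinearMap.det B ≠ 0) (x y : Euc n)
    (hy : 0 < ⟪ν, y⟫) {h : ℝ} (hh : 0 < h) :
    (volume (polarCap S ((1 + h) • y))).toReal =
      2 ^ d * |LinearMap.det B| * ⟪ν, y⟫ * (√h ^ d * h) *
        (volume (scaledCap (heightSet S L B x y h) h (heightFactor L B x h))).toReal := by
  set b := ⟪ν, y⟫ with hb
  have hs0 : 0 < √h := Real.sqrt_pos.2 hh
  set P : Euc d × ℝ →ₗ[ℝ] Euc d × ℝ :=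
    (LinearMap.transvection (LinearMap.snd ℝ (Euc d) ℝ) (isometryAdjoint L y, b - 1)) ∘ₗ
    (LinearMap.transvection
      (-((innerₗ (Euc d) (isometryAdjoint L x)) ∘ₗ LinearMap.fst ℝ (Euc d) ℝ)) (0, 1)) ∘ₗ
    (LinearMap.prodMap ((2 * √h) • B) (h • LinearMap.id)) with hP
  have hdet : LinearMap.det P = b * ((2 * √h) ^ d * LinearMap.det B * h) := by
    rw [hP, LinearMap.det_comp, LinearMap.det_comp, LinearMap.transvection.det,
      LinearMap.transvection.det, LinearMap.det_prodMap, LinearMap.det_smul, LinearMap.det_smul]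
    simp
  have hdet0 : LinearMap.det P ≠ 0 := by rw [hdet]; positivity
  set Φ := hyperplaneSplitting hdn L ν hν hL with hΦ
  have hmp : MeasurePreserving (fun q : Euc d × ℝ => Φ (WithLp.toLp 2 q)) volume volume :=
    Φ.measurePreserving.comp (WithLp.volume_preserving_toLp (Euc d) ℝ)
  have hz : ∀ p, capParam L B x y h p =
      Φ (WithLp.toLp 2 ((isometryAdjoint L y, b) + P p)) := by
    rintro ⟨ξ, s⟩
    have hPp : P (ξ, s) = ((2 * √h) • B ξ + (heightFactor L B x h (ξ, s) - 1) • isometryAdjoint L y,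
        (heightFactor L B x h (ξ, s) - 1) * b) := by
      have e : ⟪isometryAdjoint L x, (2 * √h) • B ξ⟫ = √h * ⟪x, L ((2 : ℝ) • B ξ)⟫ := by
        rw [inner_smul_right, inner_isometryAdjoint, map_smul, inner_smul_right]
        ring
      simp only [hP, heightFactor, LinearMap.comp_apply, LinearMap.transvection.apply,
        LinearMap.prodMap_apply, LinearMap.snd_apply, LinearMap.fst_apply, LinearMap.neg_apply,
        innerₗ_apply_apply, LinearMap.smul_apply, LinearMap.id_apply, Prod.smul_mk,
        Prod.mk_add_mk, e, smul_eq_mul, smul_zero, mul_one, add_zero, Prod.mk.injEq]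
      constructor
      · module
      · ring
    have hy' := eq_isometryAdjoint_add_normal hdn L hν hL y
    rw [← hb] at hy'
    rw [hPp, hΦ, hyperplaneSplitting_apply, capParam, Prod.mk_add_mk]
    generalize heightFactor L B x h (ξ, s) = c
    calc c • y + √h • L ((2 : ℝ) • B ξ)
        = c • (L (isometryAdjoint L y) + b • ν) + √h • L ((2 : ℝ) • B ξ) := by rw [← hy']
      _ = L (isometryAdjoint L y + ((2 * √h) • B ξ + (c - 1) • isometryAdjoint L y)) +
          (b + (c - 1) * b) • ν := by
        simp only [map_add, map_smul]
        module
  have hvol : volume (scaledCap (heightSet S L B x y h) h (heightFactor L B x h)) =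
      ENNReal.ofReal |(LinearMap.det P)⁻¹| * volume (polarCap S ((1 + h) • y)) := by
    have e : scaledCap (heightSet S L B x y h) h (heightFactor L B x h) =
        P ⁻¹' ((fun q => (isometryAdjoint L y, b) + q) ⁻¹'
          ((fun q => Φ (WithLp.toLp 2 q)) ⁻¹' polarCap S ((1 + h) • y))) := by
      rw [← preimage_capParam_polarCap hS hB x y hh]
      ext p
      simp only [mem_preimage, hz]
    rw [e, Measure.volume_eq_prod, Measure.addHaar_preimage_linearMap _ hdet0,
      measure_preimage_add, ← Measure.volume_eq_prod, hmp.measure_preimage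
      (measurableSet_polarCap hS _).nullMeasurableSet]
  rw [hvol, ENNReal.toReal_mul, ENNReal.toReal_ofReal (abs_nonneg _), abs_inv, hdet]
  have hBa : 0 < |LinearMap.det B| := abs_pos.2 hB0
  have : |b * ((2 * √h) ^ d * LinearMap.det B * h)| =
      2 ^ d * |LinearMap.det B| * b * (√h ^ d * h) := by
    rw [abs_mul, abs_mul, abs_mul, abs_of_pos hy, abs_of_pos hh,
      abs_of_pos (by positivity), mul_pow]
    ring
  rw [this]
  field_simp

theorem abs_heightFactor_le {S : Set (Euc n)} {L : Euc d →ₗᵢ[ℝ] Euc n} {ν : Euc n} (hν : ‖ν‖ = 1)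
    (hL : ∀ v, ⟪L v, ν⟫ = 0) {B : Euc d →ₗ[ℝ] Euc d} {R : ℝ}
    (hR : polarBody S ⊆ closedBall 0 R) {x y : Euc n} (hyS : y ∈ polarBody S)
    (hy : 0 < ⟪ν, y⟫) {h : ℝ} (hh : 0 < h) (hh1 : h ≤ 1) {p : Euc d × ℝ}
    (hp : capParam L B x y h p ∈ polarCap S ((1 + h) • y)) :
    |heightFactor L B x h p| ≤ 2 * R / ⟪ν, y⟫ := by
  have hyR : ‖y‖ ≤ R := by simpa using hR hyS
  have hR0 : 0 ≤ R := (norm_nonneg _).trans hyR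
  have hsub : convexHull ℝ (polarBody S ∪ {(1 + h) • y}) ⊆ closedBall 0 (2 * R) := by
    refine convexHull_min (union_subset (hR.trans (closedBall_subset_closedBall (by linarith))) ?_)
      (convex_closedBall _ _)
    rw [singleton_subset_iff, mem_closedBall_zero_iff, norm_smul, Real.norm_eq_abs,
      abs_of_pos (by linarith)]
    gcongr
    linarith
  have h1 : ‖capParam L B x y h p‖ ≤ 2 * R := by simpa using hsub hp.1
  have h2 : ⟪ν, capParam L B x y h p⟫ = heightFactor L B x h p * ⟪ν, y⟫ := by
    rw [capParam, inner_add_right, inner_smul_right, inner_smul_right,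
      real_inner_comm (L ((2 : ℝ) • B p.1)) ν, hL]
    ring
  have h3 : |heightFactor L B x h p| * ⟪ν, y⟫ = |heightFactor L B x h p * ⟪ν, y⟫| := by
    rw [abs_mul, abs_of_pos hy]
  rw [le_div_iff₀ hy, h3, ← h2]
  exact (abs_real_inner_le_norm _ _).trans (by rw [hν, one_mul]; exact h1)

end CapParametrization

/-- Volume asymptotics of caps of the polar body along sequences of contact pairs. -/
theorem tendsto_volume_polarCap {d n : ℕ} (hd : 1 ≤ d) (hdn : d + 1 = n) {S : Set (Euc n)}
    (hS : IsSymConvexBody S) {x₀ ν : Euc n} (hx₀ : IsOuterNormalAt S x₀ ν)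
    {L : Euc d →ₗᵢ[ℝ] Euc n} (hL : ∀ v, ⟪L v, ν⟫ = 0) {B : Euc d →ₗ[ℝ] Euc d}
    (hB : B.IsSymmetric) (hB0 : LinearMap.det B ≠ 0) (hloc : HasLocalModel S x₀ ν L B)
    {x y : ℕ → Euc n} {h : ℕ → ℝ} (hxy : ∀ k, IsContactPair S (x k) (y k))
    (hx : Tendsto x atTop (𝓝 x₀)) (hh0 : ∀ k, 0 < h k) (hh : Tendsto h atTop (𝓝 0)) :
    Tendsto (fun k => (volume (polarCap S ((1 + h k) • y k))).toReal / (√(h k) ^ d * h k)) atTop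
      (𝓝 (2 ^ d * |LinearMap.det B| * ⟪x₀, ν⟫⁻¹ *
        (2 * (volume (ball (0 : Euc d) 1)).toReal / ((d + 1) * (d + 2))))) := by
  have hν := hx₀.1
  have ha := hx₀.inner_pos hS
  have hBinj : Function.Injective B := (LinearEquiv.ofIsUnitDet (v := PiLp.basisFun 2 ℝ (Fin d))
    (v' := PiLp.basisFun 2 ℝ (Fin d)) (f := B)
    (by rw [LinearMap.det_toMatrix]; exact isUnit_iff_ne_zero.2 hB0)).injective
  have hBsurj : Function.Surjective B := LinearMap.surjective_of_injective hBinj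
  obtain ⟨K, hK0, hK⟩ := B.exists_antilipschitzWith (LinearMap.ker_eq_bot.2 hBinj)
  have hKB : ∀ w, ‖w‖ ≤ K * ‖B w‖ := fun w => by simpa using hK.le_mul_dist w 0
  have hBcont : Continuous B := B.continuous_of_finiteDimensional
  have hxd : Tendsto (fun k => ‖x k - x₀‖) atTop (𝓝 0) := tendsto_iff_norm_sub_tendsto_zero.1 hx
  have hyt : Tendsto y atTop (𝓝 (⟪x₀, ν⟫⁻¹ • ν)) := by
    rw [tendsto_iff_norm_sub_tendsto_zero, Metric.tendsto_nhds]
    intro ε hε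
    obtain ⟨r, hr, c, -, hc⟩ := hloc (ε / 2) (half_pos hε)
    filter_upwards [hxd.eventually (gt_mem_nhds hr)] with k hk
    have := (hc _ _ (hxy k) hk).1
    rw [dist_zero_right, norm_norm]
    linarith
  have hbt : Tendsto (fun k => ⟪ν, y k⟫) atTop (𝓝 ⟪x₀, ν⟫⁻¹) := by
    have h1 : Tendsto (fun k => ⟪ν, y k⟫) atTop (𝓝 ⟪ν, ⟪x₀, ν⟫⁻¹ • ν⟫) :=
      tendsto_const_nhds.inner hyt
    rwa [inner_smul_right, real_inner_self_eq_norm_sq, hν, one_pow, mul_one] at h1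
  have hbpos : ∀ᶠ k in atTop, ⟪x₀, ν⟫⁻¹ / 2 < ⟪ν, y k⟫ :=
    hbt.eventually (lt_mem_nhds (half_lt_self (inv_pos.2 ha)))
  have hst : Tendsto (fun k => √(h k)) atTop (𝓝 0) := by
    have := (Real.continuous_sqrt.tendsto 0).comp hh
    rwa [Real.sqrt_zero] at this
  obtain ⟨R, hR0, hR⟩ := hS.polarBody_subset_closedBall
  obtain ⟨R', hR0', hR'⟩ := hS.1.isBounded.subset_closedBall_lt 0 0
  have hs : ∀ k, 0 < √(h k) := fun k => Real.sqrt_pos.2 (hh0 k)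
  have hsq : ∀ k, √(h k) ^ 2 = h k := fun k => Real.sq_sqrt (hh0 k).le
  have hnorm : ∀ k (w : Euc d), ‖(√(h k))⁻¹ • w‖ ^ 2 = ‖w‖ ^ 2 / h k := fun k w => by
    rw [norm_smul, mul_pow, norm_inv, inv_pow, Real.norm_eq_abs, sq_abs, hsq]
    field_simp
  set W : ℕ → Set (Euc d × ℝ) := fun k => heightSet S L B (x k) (y k) (h k) with hW
  set m : ℕ → Euc d × ℝ → ℝ := fun k => heightFactor L B (x k) (h k) with hm
  have hq : ∀ k, ∀ w ∈ W k, 0 ≤ w.2 := by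
    rintro k _ ⟨x', hx', rfl⟩
    exact div_nonneg (by linarith [(hxy k).2.1 x' hx']) (hh0 k).le
  have hcap := tendsto_volume_scaledCap (W := W) (h := h) (m := m) hd
    (tendsto_nhdsWithin_iff.2 ⟨hh, Eventually.of_forall hh0⟩) hq ?_ ?_ ?_ ?_ ?_ ?_
  rotate_left
  · intro R₁ ε hε
    obtain ⟨r, hr, c, -, hc⟩ := hloc (ε / (R₁ ^ 2 + 1)) (by positivity)
    have e1 : Tendsto (fun k => K * (√(h k) * R₁)) atTop (𝓝 0) := by
      simpa using (hst.mul_const R₁).const_mul (K : ℝ)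
    filter_upwards [hxd.eventually (gt_mem_nhds hr), e1.eventually (gt_mem_nhds hr)]
      with k h1 h2 ω hω
    obtain ⟨w, hw⟩ := hBsurj (√(h k) • ω)
    have hwr : ‖w‖ < r := by
      refine lt_of_le_of_lt ((hKB w).trans ?_) h2
      rw [hw, norm_smul, Real.norm_eq_abs, abs_of_pos (hs k)]
      have := (hs k).le
      gcongr
    obtain ⟨x', hx', hLx, hest⟩ := (hc _ _ (hxy k) h1).2.1 w hwr
    have hωeq : ω = (√(h k))⁻¹ • B (isometryAdjoint L (x' - x k)) := by
      rw [hLx, hw, smul_smul, inv_mul_cancel₀ (hs k).ne', one_smul]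
    refine ⟨(1 - ⟪x', y k⟫) / h k, ⟨x', hx', ?_⟩, ?_⟩
    · simp only [hωeq]
    · have hωn : ‖B w‖ ^ 2 = h k * ‖ω‖ ^ 2 := by
        rw [hw, norm_smul, mul_pow, Real.norm_eq_abs, sq_abs, hsq]
      rw [hωn] at hest
      have h3 : (1 - ⟪x', y k⟫) / h k - ‖ω‖ ^ 2 = (1 - ⟪x', y k⟫ - h k * ‖ω‖ ^ 2) / h k := by
        have := (hh0 k).ne'
        field_simp
      rw [h3, abs_div, abs_of_pos (hh0 k), div_le_iff₀ (hh0 k)]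
      refine hest.trans ?_
      have h4 : ‖ω‖ ^ 2 ≤ R₁ ^ 2 + 1 := by
        have := pow_le_pow_left₀ (norm_nonneg ω) hω 2
        linarith
      have := (hh0 k).le
      calc ε / (R₁ ^ 2 + 1) * (h k * ‖ω‖ ^ 2) ≤ ε / (R₁ ^ 2 + 1) * (h k * (R₁ ^ 2 + 1)) := by gcongr
        _ = ε * h k := by field_simp
  · obtain ⟨r, hr, c, hc0, hc⟩ := hloc (1 / 2) one_half_pos
    obtain ⟨M, hM0, hM⟩ : ∃ M > 0, ∀ v ∈ closedBall (0 : Euc d) (2 * R'), ‖B v‖ ^ 2 ≤ M := by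
      obtain ⟨M, hM⟩ := (isCompact_closedBall (0 : Euc d) (2 * R')).bddAbove_image
        (f := fun v => ‖B v‖ ^ 2) (by fun_prop)
      exact ⟨max M 1, by positivity, fun v hv => (hM ⟨v, hv, rfl⟩).trans (le_max_left _ _)⟩
    refine ⟨max 2 (M / c), by positivity, ?_⟩
    filter_upwards [hxd.eventually (gt_mem_nhds hr)] with k h1
    rintro _ ⟨x', hx', rfl⟩
    simp only
    rw [hnorm, ← mul_div_assoc]
    refine div_le_div_of_nonneg_right ?_ (hh0 k).le
    have h0 : 0 ≤ 1 - ⟪x', y k⟫ := by linarith [(hxy k).2.1 x' hx']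
    rcases lt_or_ge (1 - ⟪x', y k⟫) c with hlt | hge
    · have := (hc _ _ (hxy k) h1).2.2 x' hx' hlt
      calc ‖B (isometryAdjoint L (x' - x k))‖ ^ 2 ≤ 2 * (1 - ⟪x', y k⟫) := by linarith
        _ ≤ max 2 (M / c) * (1 - ⟪x', y k⟫) := by gcongr; exact le_max_left _ _
    · calc ‖B (isometryAdjoint L (x' - x k))‖ ^ 2 ≤ M := by
            refine hM _ ?_
            rw [mem_closedBall_zero_iff]
            have h2 : ‖x'‖ ≤ R' := by simpa using hR' hx'
            have h3 : ‖x k‖ ≤ R' := by simpa using hR' (hxy k).1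
            linarith [norm_isometryAdjoint_le L (x' - x k), norm_sub_le x' (x k)]
        _ = M / c * c := by field_simp
        _ ≤ max 2 (M / c) * (1 - ⟪x', y k⟫) := by gcongr; exact le_max_right _ _
  · intro R₁ ε hε
    set ε' := min (1 / 2) (ε / (2 * (|R₁| + 1))) with hε'
    obtain ⟨r, hr, c, hc0, hc⟩ := hloc ε' (by positivity)
    have e1 : Tendsto (fun k => R₁ * h k) atTop (𝓝 0) := by
      simpa using hh.const_mul R₁
    filter_upwards [hxd.eventually (gt_mem_nhds hr), e1.eventually (gt_mem_nhds hc0)] with k h1 h2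
    rintro _ ⟨x', hx', rfl⟩ hqR
    simp only at hqR ⊢
    rw [hnorm]
    have hqR' := (div_le_iff₀ (hh0 k)).1 hqR
    have h3 := (hc _ _ (hxy k) h1).2.2 x' hx' (by linarith)
    have h0 : 0 ≤ (1 - ⟪x', y k⟫) / h k :=
      div_nonneg (by linarith [(hxy k).2.1 x' hx']) (hh0 k).le
    set N := ‖B (isometryAdjoint L (x' - x k))‖ ^ 2 / h k with hN
    set q := (1 - ⟪x', y k⟫) / h k with hqd
    have h4 : (1 - ε') * N ≤ q := by
      rw [hN, hqd, ← mul_div_assoc]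
      exact div_le_div_of_nonneg_right h3 (hh0 k).le
    have hN0 : 0 ≤ N := div_nonneg (by positivity) (hh0 k).le
    have h5 : ε' ≤ 1 / 2 := min_le_left _ _
    have h6 : N ≤ 2 * q := by nlinarith
    have h7 : ε' * N ≤ ε / (2 * (|R₁| + 1)) * (2 * (|R₁| + 1)) := by
      have : N ≤ 2 * (|R₁| + 1) := by linarith [le_abs_self R₁]
      have h8 : ε' ≤ ε / (2 * (|R₁| + 1)) := min_le_right _ _
      gcongr
    rw [div_mul_cancel₀ _ (by positivity)] at h7
    linarith
  · refine ⟨2 * R / (⟪x₀, ν⟫⁻¹ / 2), ?_⟩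
    filter_upwards [hbpos, hh.eventually (gt_mem_nhds one_pos)] with k h1 h2 p hp
    have hai := inv_pos.2 ha
    rw [hW, hm, ← preimage_capParam_polarCap hS hB (x k) (y k) (hh0 k)] at hp
    refine (abs_heightFactor_le hν hL hR (hxy k).2.1 (by linarith) (hh0 k) h2.le hp).trans ?_
    have : 0 < ⟪ν, y k⟫ := by linarith
    gcongr
  · intro p
    have h1 : Tendsto (fun k => ⟪x k, L ((2 : ℝ) • B p.1)⟫) atTop (𝓝 ⟪x₀, L ((2 : ℝ) • B p.1)⟫) :=
      hx.inner tendsto_const_nhds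
    have := ((hh.mul_const p.2).const_add 1).sub (hst.mul h1)
    simpa [hm, heightFactor] using this
  · exact fun k => measurableSet_scaledCap_heightSet hS hB _ _ (hh0 k)
  have hlim := (ENNReal.tendsto_toReal
    (by rw [volume_limitCap hd]; exact ENNReal.ofReal_ne_top)).comp hcap
  rw [volume_limitCap hd, ENNReal.toReal_ofReal (by positivity)] at hlim
  refine ((hbt.const_mul (2 ^ d * |LinearMap.det B|)).mul hlim).congr' ?_
  filter_upwards [hbpos] with k h1
  have hb : 0 < ⟪ν, y k⟫ := by linarith [inv_pos.2 ha]
  rw [volume_polarCap_eq hdn hS hν hL hB hB0 (x k) (y k) hb (hh0 k)]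
  have h3 := (hh0 k).ne'
  have h4 := (hs k).ne'
  simp only [Function.comp_apply]
  field_simp
  rfl

theorem sqrt_pow_rpow (n : ℕ) {t : ℝ} (ht : 0 ≤ t) :
    (√t ^ (n + 1)) ^ ((2 : ℝ) / (n + 1)) = t := by
  have hn : (n : ℝ) + 1 ≠ 0 := by positivity
  rw [Real.sqrt_eq_rpow, ← Real.rpow_natCast, ← Real.rpow_mul ht, ← Real.rpow_mul ht]
  push_cast
  rw [show 1 / 2 * ((n : ℝ) + 1) * (2 / (n + 1)) = 1 by field_simp, Real.rpow_one]

theorem sqrt_rpow_pow (n : ℕ) {t : ℝ} (ht : 0 ≤ t) :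
    √(t ^ ((2 : ℝ) / (n + 1))) ^ (n + 1) = t := by
  have hn : (n : ℝ) + 1 ≠ 0 := by positivity
  rw [Real.sqrt_eq_rpow, ← Real.rpow_natCast, ← Real.rpow_mul ht, ← Real.rpow_mul ht]
  push_cast
  rw [show 2 / ((n : ℝ) + 1) * (1 / 2) * (n + 1) = 1 by field_simp, Real.rpow_one]

theorem IsSymConvexBody.cConst_pos {n : ℕ} {S : Set (Euc n)} (hS : IsSymConvexBody S) :
    0 < cConst n S := by
  have h1 := ENNReal.toReal_pos hS.volume_pos.ne' hS.1.measure_lt_top.ne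
  have h2 := ENNReal.toReal_pos (measure_ball_pos volume (0 : Euc (n - 1)) one_pos).ne'
    measure_ball_lt_top.ne
  unfold cConst
  positivity

theorem IsSymConvexBody.cConst_polarBody_pos {n : ℕ} {S : Set (Euc n)} (hS : IsSymConvexBody S) :
    0 < cConst n (polarBody S) := by
  have h1 := ENNReal.toReal_pos hS.volume_polarBody_pos.ne'
    hS.polarBody_isCompact.measure_lt_top.ne
  have h2 := ENNReal.toReal_pos (measure_ball_pos volume (0 : Euc (n - 1)) one_pos).ne'
    measure_ball_lt_top.ne
  unfold cConst
  positivity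

/-- The leading coefficient of the volume of a cap of the polar body, in terms of the Gauss
curvature `k` and the support distance `a` at the corresponding boundary point. -/
def capRate (n : ℕ) (k a : ℝ) : ℝ :=
  2 ^ (n - 1) * √(k / (2 * a) ^ (n - 1)) * a⁻¹ *
    (2 * (volume (ball (0 : Euc (n - 1)) 1)).toReal / (n * (n + 1)))

theorem capRate_pos {n : ℕ} (hn : 1 ≤ n) {k a : ℝ} (hk : 0 < k) (ha : 0 < a) :
    0 < capRate n k a := by
  have h2 := ENNReal.toReal_pos (measure_ball_pos volume (0 : Euc (n - 1)) one_pos).ne'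
    measure_ball_lt_top.ne
  have : (0 : ℝ) < n := by exact_mod_cast hn
  unfold capRate
  positivity

theorem capRate_mul_sqrt_pow {n : ℕ} (hn : 1 ≤ n) {S : Set (Euc n)} (hS : IsSymConvexBody S)
    {u : Euc n → Euc n} {κ : Euc n → ℝ} {x : Euc n} (hκ : 0 < κ x) (ha : 0 < ⟪x, u x⟫) :
    capRate n (κ x) ⟪x, u x⟫ *
      √((n : ℝ) ^ ((2 : ℝ) / (n + 1)) * cConst n S * cConst n (polarBody S) /
        Gfun S u κ x) ^ (n + 1)
      = (volume (polarBody S)).toReal := by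
  have hcS := hS.cConst_pos
  have hV := ENNReal.toReal_pos hS.volume_polarBody_pos.ne'
    hS.polarBody_isCompact.measure_lt_top.ne
  have hω := ENNReal.toReal_pos (measure_ball_pos volume (0 : Euc (n - 1)) one_pos).ne'
    measure_ball_lt_top.ne
  have hn0 : (0 : ℝ) < n := by exact_mod_cast hn
  have hn1 : (n : ℝ) + 1 ≠ 0 := by positivity
  have hpow : ∀ {t : ℝ}, 0 ≤ t → (t ^ ((2 : ℝ) / (n + 1))) ^ (n + 1) = t ^ 2 := fun ht => by
    rw [← Real.rpow_natCast, ← Real.rpow_mul ht, ← Real.rpow_natCast]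
    congr 1
    push_cast
    field_simp
  have hpow1 : (κ x ^ ((1 : ℝ) / (n + 1))) ^ (n + 1) = κ x := by
    rw [← Real.rpow_natCast, ← Real.rpow_mul hκ.le]
    push_cast
    rw [one_div_mul_cancel hn1, Real.rpow_one]
  have hg := capRate_pos hn hκ ha
  have hκp : 0 < κ x ^ ((1 : ℝ) / (n + 1)) := by positivity
  rw [Gfun]
  set V := (volume (polarBody S)).toReal
  set a := ⟪x, u x⟫
  set q := κ x ^ ((1 : ℝ) / (n + 1))
  have hT : (n : ℝ) ^ ((2 : ℝ) / (n + 1)) * cConst n S * cConst n (polarBody S) /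
      (cConst n S * q / a) = (n : ℝ) ^ ((2 : ℝ) / (n + 1)) * cConst n (polarBody S) * a / q := by
    field_simp
  rw [hT]
  set ω := (volume (ball (0 : Euc (n - 1)) 1)).toReal
  set T := (n : ℝ) ^ ((2 : ℝ) / (n + 1)) * cConst n (polarBody S) * a / q with hTd
  have hT0 : 0 < T := by
    have := hS.cConst_polarBody_pos
    positivity
  have hTpow : T ^ (n + 1) =
      n ^ 2 * ((n + 1) ^ 2 * (V / ω) ^ 2 / 2 ^ (n + 1)) * a ^ (n + 1) / κ x := by
    rw [hTd, cConst, div_pow, mul_pow, mul_pow, mul_pow, div_pow, hpow hn0.le, hpow (by positivity),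
      hpow (by positivity), hpow1]
    ring
  refine (pow_left_inj₀ (by positivity) hV.le two_ne_zero).1 ?_
  rw [mul_pow, ← pow_mul, mul_comm (n + 1) 2, pow_mul, Real.sq_sqrt hT0.le, hTpow, capRate]
  have hsplit : ∀ t : ℝ, t ^ (n + 1) = t ^ (n - 1) * t ^ 2 := fun t => by
    rw [← pow_add]
    congr 1
    omega
  rw [mul_pow, mul_pow, mul_pow, Real.sq_sqrt (by positivity), hsplit a, hsplit 2, mul_pow]
  change _ * (2 * ω / _) ^ 2 * _ = _
  field_simp

theorem Gfun_eq_capRate_rpow {n : ℕ} (hn : 1 ≤ n) {S : Set (Euc n)} (hS : IsSymConvexBody S)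
    {u : Euc n → Euc n} {κ : Euc n → ℝ} {x : Euc n} (hκ : 0 < κ x) (ha : 0 < ⟪x, u x⟫) :
    Gfun S u κ x = (n : ℝ) ^ ((2 : ℝ) / (n + 1)) * cConst n S * cConst n (polarBody S) /
      (volume (polarBody S)).toReal ^ ((2 : ℝ) / (n + 1)) *
      capRate n (κ x) ⟪x, u x⟫ ^ ((2 : ℝ) / (n + 1)) := by
  have hcS := hS.cConst_pos
  have hcK := hS.cConst_polarBody_pos
  have hn0 : (0 : ℝ) < n := by exact_mod_cast hn
  have hg := capRate_pos hn hκ ha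
  have hG : 0 < Gfun S u κ x := by unfold Gfun; positivity
  rw [← capRate_mul_sqrt_pow hn hS hκ ha, Real.mul_rpow hg.le (by positivity),
    sqrt_pow_rpow n (by positivity)]
  have : 0 < capRate n (κ x) ⟪x, u x⟫ ^ ((2 : ℝ) / (n + 1)) := by positivity
  field_simp

theorem tendsto_volume_polarCap_capRate {n : ℕ} (hn : 2 ≤ n) {S : Set (Euc n)}
    {u : Euc n → Euc n} {κ : Euc n → ℝ} (hS : IsSymConvexBody S) (hC2 : IsC2Body S u κ)
    (hκ : ∀ x ∈ frontier S, 0 < κ x) {x₀ : Euc n} (hx₀ : x₀ ∈ frontier S)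
    {x y : ℕ → Euc n} {h : ℕ → ℝ} (hxy : ∀ k, IsContactPair S (x k) (y k))
    (hx : Tendsto x atTop (𝓝 x₀)) (hh0 : ∀ k, 0 < h k) (hh : Tendsto h atTop (𝓝 0)) :
    Tendsto (fun k => (volume (polarCap S ((1 + h k) • y k))).toReal / √(h k) ^ (n + 1)) atTop
      (𝓝 (capRate n (κ x₀) ⟪x₀, u x₀⟫)) := by
  obtain ⟨hν, L, f, τ, ε, hτ, hε, hL, hf, hf0, hf1, hgr, hk⟩ := hC2 x₀ hx₀
  have hdn : n - 1 + 1 = n := by omega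
  have ha := hν.inner_pos hS
  obtain ⟨B, hB, hdet, hloc⟩ := hasLocalModel_of_graph hdn hS (fun x hx => ⟨u x, (hC2 x hx).1⟩)
    hx₀ hν hτ hε hL hf hf0 hf1 hgr (hκ x₀ hx₀) hk
  have hB0 : LinearMap.det B ≠ 0 := by
    intro h0
    have := hκ x₀ hx₀
    rw [← hdet, h0] at this
    simp at this
  have hlim := tendsto_volume_polarCap (by omega) hdn hS hν hL hB hB0 hloc hxy hx hh0 hh
  have hcast : ((n - 1 : ℕ) : ℝ) = n - 1 := by rw [Nat.cast_sub (by omega), Nat.cast_one]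
  have hrate : capRate n (κ x₀) ⟪x₀, u x₀⟫ = 2 ^ (n - 1) * |LinearMap.det B| * ⟪x₀, u x₀⟫⁻¹ *
      (2 * (volume (ball (0 : Euc (n - 1)) 1)).toReal /
        (((n - 1 : ℕ) + 1) * ((n - 1 : ℕ) + 2))) := by
    rw [capRate, ← hdet, mul_div_cancel_left₀ _ (by positivity), Real.sqrt_sq_eq_abs, hcast]
    congr 2
    ring
  rw [hrate]
  refine hlim.congr fun k => ?_
  have hs : √(h k) ^ (n + 1) = √(h k) ^ (n - 1) * h k := by
    nth_rewrite 3 [← Real.sq_sqrt (hh0 k).le]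
    rw [← pow_add]
    congr 1
    omega
  rw [hs]

section CurvatureBounds

variable {n : ℕ} {S : Set (Euc n)} {u : Euc n → Euc n} {κ : Euc n → ℝ}

theorem tendsto_capRate (hn : 2 ≤ n) (hS : IsSymConvexBody S) (hC2 : IsC2Body S u κ)
    (hκ : ∀ x ∈ frontier S, 0 < κ x) {x₀ : Euc n} (hx₀ : x₀ ∈ frontier S) {x : ℕ → Euc n}
    (hxS : ∀ k, x k ∈ frontier S) (hx : Tendsto x atTop (𝓝 x₀)) :
    Tendsto (fun k => capRate n (κ (x k)) ⟪x k, u (x k)⟫) atTop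
      (𝓝 (capRate n (κ x₀) ⟪x₀, u x₀⟫)) := by
  set y : ℕ → Euc n := fun k => ⟪x k, u (x k)⟫⁻¹ • u (x k) with hy
  have hxy : ∀ k, IsContactPair S (x k) (y k) := fun k =>
    (hC2 _ (hxS k)).1.isContactPair hS (hxS k)
  have key : ∀ k : ℕ, ∃ h : ℝ, 0 < h ∧ h < 1 / ((k : ℝ) + 1) ∧
      dist ((volume (polarCap S ((1 + h) • y k))).toReal / √h ^ (n + 1))
        (capRate n (κ (x k)) ⟪x k, u (x k)⟫) < 1 / ((k : ℝ) + 1) := by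
    intro k
    have hk : (0 : ℝ) < 1 / ((k : ℝ) + 1) := Nat.one_div_pos_of_nat
    have hz := tendsto_one_div_add_atTop_nhds_zero_nat (𝕜 := ℝ)
    have := tendsto_volume_polarCap_capRate hn hS hC2 hκ (hxS k) (x := fun _ => x k)
      (y := fun _ => y k) (fun _ => hxy k) tendsto_const_nhds
      (fun _ => Nat.one_div_pos_of_nat) hz
    obtain ⟨j, hj1, hj2⟩ := ((hz.eventually (gt_mem_nhds hk)).and
      (Metric.tendsto_nhds.1 this _ hk)).exists
    exact ⟨_, Nat.one_div_pos_of_nat, hj1, hj2⟩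
  choose h hh0 hh1 hh2 using key
  have hz := tendsto_one_div_add_atTop_nhds_zero_nat (𝕜 := ℝ)
  have hh : Tendsto h atTop (𝓝 0) :=
    squeeze_zero (fun k => (hh0 k).le) (fun k => (hh1 k).le) hz
  have hlim := tendsto_volume_polarCap_capRate hn hS hC2 hκ hx₀ hxy hx hh0 hh
  exact hlim.congr_dist (squeeze_zero (fun _ => dist_nonneg) (fun k => (hh2 k).le) hz)

theorem continuousOn_Gfun (hn : 2 ≤ n) (hS : IsSymConvexBody S) (hC2 : IsC2Body S u κ)
    (hκ : ∀ x ∈ frontier S, 0 < κ x) : ContinuousOn (Gfun S u κ) (frontier S) := by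
  have ha : ∀ x ∈ frontier S, 0 < ⟪x, u x⟫ := fun x hx => (hC2 x hx).1.inner_pos hS
  have hg : ContinuousOn (fun x => capRate n (κ x) ⟪x, u x⟫) (frontier S) := by
    rw [continuousOn_iff_continuous_domRestrict]
    refine SeqContinuous.continuous fun x x₀ hx => ?_
    exact tendsto_capRate hn hS hC2 hκ x₀.2 (fun k => (x k).2)
      ((continuous_subtype_val.tendsto x₀).comp hx)
  exact (continuousOn_const.mul (hg.rpow_const fun x hx =>
    Or.inl (capRate_pos (by omega) (hκ x hx) (ha x hx)).ne')).congr fun x hx =>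
      Gfun_eq_capRate_rpow (by omega) hS (hκ x hx) (ha x hx)

theorem IsSymConvexBody.isCompact_frontier (hS : IsSymConvexBody S) : IsCompact (frontier S) :=
  hS.1.of_isClosed_subset isClosed_frontier hS.1.isClosed.frontier_subset

theorem IsSymConvexBody.frontier_nonempty (hn : 1 ≤ n) (hS : IsSymConvexBody S) :
    (frontier S).Nonempty := by
  obtain ⟨x, y, t, -, hxy, -⟩ := exists_isContactPair_smul hS
    (z := EuclideanSpace.single (⟨0, hn⟩ : Fin n) (1 : ℝ)) (by simp)
  exact ⟨x, hxy.mem_frontier⟩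

theorem exists_Gfun_bounds (hn : 2 ≤ n) (hS : IsSymConvexBody S) (hC2 : IsC2Body S u κ)
    (hκ : ∀ x ∈ frontier S, 0 < κ x) :
    0 < sInf (Gfun S u κ '' frontier S) ∧ ∀ x ∈ frontier S,
      sInf (Gfun S u κ '' frontier S) ≤ Gfun S u κ x ∧
      Gfun S u κ x ≤ sSup (Gfun S u κ '' frontier S) := by
  have hcomp := hS.isCompact_frontier.image_of_continuousOn (continuousOn_Gfun hn hS hC2 hκ)
  have hne := (hS.frontier_nonempty (by omega)).image (Gfun S u κ)
  obtain ⟨x, hx, hxm⟩ := hcomp.sInf_mem hne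
  refine ⟨?_, fun x hx => ⟨csInf_le hcomp.bddBelow (mem_image_of_mem _ hx),
    le_csSup hcomp.bddAbove (mem_image_of_mem _ hx)⟩⟩
  have hcS := hS.cConst_pos
  have ha := (hC2 x hx).1.inner_pos hS
  have := hκ x hx
  rw [← hxm]
  unfold Gfun
  positivity

/-- Asymptotics of cap volumes when the relative height of the cap is comparable to
`δ ^ (2 / (n + 1))`. -/
theorem tendsto_volume_polarCap_div (hn : 2 ≤ n) (hS : IsSymConvexBody S) (hC2 : IsC2Body S u κ)
    (hκ : ∀ x ∈ frontier S, 0 < κ x) {x₀ : Euc n} (hx₀ : x₀ ∈ frontier S)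
    {x y : ℕ → Euc n} {δ h : ℕ → ℝ} (hxy : ∀ k, IsContactPair S (x k) (y k))
    (hx : Tendsto x atTop (𝓝 x₀)) (hδ0 : ∀ k, 0 < δ k) (hδ : Tendsto δ atTop (𝓝 0))
    (hh0 : ∀ k, 0 < h k) {c : ℝ}
    (hh : Tendsto (fun k => h k / δ k ^ ((2 : ℝ) / (n + 1))) atTop (𝓝 c)) :
    Tendsto (fun k => (volume (polarCap S ((1 + h k) • y k))).toReal / δ k) atTop
      (𝓝 (capRate n (κ x₀) ⟪x₀, u x₀⟫ * √c ^ (n + 1))) := by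
  have hr : ∀ k, 0 < δ k ^ ((2 : ℝ) / (n + 1)) := fun k => Real.rpow_pos_of_pos (hδ0 k) _
  have hrt : Tendsto (fun k => δ k ^ ((2 : ℝ) / (n + 1))) atTop (𝓝 0) := by
    have := hδ.rpow_const (p := (2 : ℝ) / (n + 1)) (Or.inr (by positivity))
    rwa [Real.zero_rpow (by positivity)] at this
  have hht : Tendsto h atTop (𝓝 0) := by
    have := hh.mul hrt
    rw [mul_zero] at this
    exact this.congr fun k => div_mul_cancel₀ _ (hr k).ne'
  have hlim := tendsto_volume_polarCap_capRate hn hS hC2 hκ hx₀ hxy hx hh0 hht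
  have hs := (((Real.continuous_sqrt.tendsto c).comp hh).pow (n + 1))
  refine (hlim.mul hs).congr fun k => ?_
  have h1 : √(h k) ^ (n + 1) ≠ 0 := (pow_pos (Real.sqrt_pos.2 (hh0 k)) _).ne'
  rw [Function.comp_apply, Real.sqrt_div (hh0 k).le, div_pow, sqrt_rpow_pow n (hδ0 k).le]
  field_simp

end CurvatureBounds

theorem eventually_forall_isContactPair {n : ℕ} {S : Set (Euc n)} (hS : IsSymConvexBody S)
    {P : ℝ → Euc n → Prop} {Q : ℝ → Prop} (hQ : ∀ᶠ δ in 𝓝[>] 0, Q δ)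
    (H : ∀ (δ : ℕ → ℝ) (x y : ℕ → Euc n), ∀ x₀ ∈ frontier S,
      (∀ k, 0 < δ k) → Tendsto δ atTop (𝓝 0) → (∀ k, Q (δ k)) →
      (∀ k, IsContactPair S (x k) (y k)) → Tendsto x atTop (𝓝 x₀) →
      ∃ k, P (δ k) (y k)) :
    ∀ᶠ δ in 𝓝[>] 0, ∀ x y, IsContactPair S x y → P δ y := by
  by_contra hcon
  rw [not_eventually] at hcon
  obtain ⟨δ, hδ, hδP⟩ := exists_seq_forall_of_frequently
    (hcon.and_eventually (hQ.and self_mem_nhdsWithin))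
  choose hP hQδ hδ0 using hδP
  push Not at hP
  choose x y hxy hP using hP
  obtain ⟨x₀, hx₀, φ, hφ, hlim⟩ := hS.isCompact_frontier.tendsto_subseq
    fun k => (hxy k).mem_frontier
  obtain ⟨k, hk⟩ := H (δ ∘ φ) (x ∘ φ) (y ∘ φ) x₀ hx₀ (fun k => hδ0 _)
    ((tendsto_nhds_of_tendsto_nhdsWithin hδ).comp hφ.tendsto_atTop) (fun k => hQδ _)
    (fun k => hxy _) hlim
  exact hP _ hk

section CapComparison

variable {n : ℕ} {S : Set (Euc n)} {u : Euc n → Euc n} {κ : Euc n → ℝ}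

theorem eventually_lt_volume_polarCap (hn : 2 ≤ n) (hS : IsSymConvexBody S)
    (hC2 : IsC2Body S u κ) (hκ : ∀ x ∈ frontier S, 0 < κ x) {c : ℝ} (hc0 : 0 < c)
    (hc : ∀ x ∈ frontier S,
      (n : ℝ) ^ ((2 : ℝ) / (n + 1)) * cConst n S * cConst n (polarBody S) / Gfun S u κ x < c) :
    ∀ᶠ δ : ℝ in 𝓝[>] 0, ∀ x y, IsContactPair S x y → δ * (volume (polarBody S)).toReal <
      (volume (polarCap S ((1 + c * δ ^ ((2 : ℝ) / (n + 1))) • y))).toReal := by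
  refine eventually_forall_isContactPair hS (P := fun δ y => δ * (volume (polarBody S)).toReal <
    (volume (polarCap S ((1 + c * δ ^ ((2 : ℝ) / (n + 1))) • y))).toReal) (Q := fun _ => True)
    (Eventually.of_forall fun _ => trivial) ?_
  intro δ x y x₀ hx₀ hδ0 hδ _ hxy hx
  have hr : ∀ k, 0 < δ k ^ ((2 : ℝ) / (n + 1)) := fun k => Real.rpow_pos_of_pos (hδ0 k) _
  have hlim := tendsto_volume_polarCap_div hn hS hC2 hκ hx₀ hxy hx hδ0 hδ
    (h := fun k => c * δ k ^ ((2 : ℝ) / (n + 1))) (fun k => mul_pos hc0 (hr k)) (c := c)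
    (tendsto_const_nhds.congr fun k => (mul_div_cancel_right₀ _ (hr k).ne').symm)
  have ha := (hC2 x₀ hx₀).1.inner_pos hS
  have hg := capRate_pos (n := n) (by omega) (hκ x₀ hx₀) ha
  have hlt : (volume (polarBody S)).toReal < capRate n (κ x₀) ⟪x₀, u x₀⟫ * √c ^ (n + 1) := by
    rw [← capRate_mul_sqrt_pow (by omega) hS (hκ x₀ hx₀) ha]
    exact mul_lt_mul_of_pos_left (pow_lt_pow_left₀
      (Real.sqrt_lt_sqrt_iff_of_pos hc0 |>.2 (hc x₀ hx₀)) (Real.sqrt_nonneg _) (by omega)) hg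
  obtain ⟨k, hk⟩ := (hlim.eventually (lt_mem_nhds hlt)).exists
  exact ⟨k, by rwa [lt_div_iff₀ (hδ0 k), mul_comm] at hk⟩

theorem eventually_volume_polarCap_lt (hn : 2 ≤ n) (hS : IsSymConvexBody S)
    (hC2 : IsC2Body S u κ) (hκ : ∀ x ∈ frontier S, 0 < κ x) {c : ℝ} (hc0 : 0 < c)
    (hc : ∀ x ∈ frontier S,
      c < (n : ℝ) ^ ((2 : ℝ) / (n + 1)) * cConst n S * cConst n (polarBody S) / Gfun S u κ x) :
    ∀ᶠ δ : ℝ in 𝓝[>] 0, ∀ x y, IsContactPair S x y →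
      (volume (polarCap S ((1 - c * δ ^ ((2 : ℝ) / (n + 1)))⁻¹ • y))).toReal <
        δ * (volume (polarBody S)).toReal := by
  have hp : (0 : ℝ) < (2 : ℝ) / (n + 1) := by positivity
  have hsmall : Tendsto (fun δ : ℝ => 1 - c * δ ^ ((2 : ℝ) / (n + 1))) (𝓝 0) (𝓝 1) := by
    have := ((tendsto_id (α := ℝ) (x := 𝓝 0)).rpow_const (p := (2 : ℝ) / (n + 1))
      (Or.inr hp.le)).const_mul c |>.const_sub 1
    simpa [Real.zero_rpow hp.ne'] using this
  refine eventually_forall_isContactPair hS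
    (P := fun δ y => (volume (polarCap S ((1 - c * δ ^ ((2 : ℝ) / (n + 1)))⁻¹ • y))).toReal <
      δ * (volume (polarBody S)).toReal) (Q := fun δ => 0 < 1 - c * δ ^ ((2 : ℝ) / (n + 1)))
    ((hsmall.eventually (lt_mem_nhds one_pos)).filter_mono nhdsWithin_le_nhds) ?_
  intro δ x y x₀ hx₀ hδ0 hδ hQ hxy hx
  have hr : ∀ k, 0 < δ k ^ ((2 : ℝ) / (n + 1)) := fun k => Real.rpow_pos_of_pos (hδ0 k) _
  have hh : ∀ k, (1 - c * δ k ^ ((2 : ℝ) / (n + 1)))⁻¹ - 1 =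
      c * (1 - c * δ k ^ ((2 : ℝ) / (n + 1)))⁻¹ * δ k ^ ((2 : ℝ) / (n + 1)) := fun k => by
    have := (hQ k).ne'
    field_simp
    ring
  have hlim := tendsto_volume_polarCap_div hn hS hC2 hκ hx₀ hxy hx hδ0 hδ
    (h := fun k => (1 - c * δ k ^ ((2 : ℝ) / (n + 1)))⁻¹ - 1)
    (fun k => by rw [hh]; exact mul_pos (mul_pos hc0 (inv_pos.2 (hQ k))) (hr k)) (c := c) (by
      have h1 := ((hsmall.comp hδ).inv₀ one_ne_zero).const_mul c
      rw [inv_one, mul_one] at h1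
      refine h1.congr fun k => ?_
      rw [hh, mul_div_cancel_right₀ _ (hr k).ne']
      rfl)
  have ha := (hC2 x₀ hx₀).1.inner_pos hS
  have hg := capRate_pos (n := n) (by omega) (hκ x₀ hx₀) ha
  have hlt : capRate n (κ x₀) ⟪x₀, u x₀⟫ * √c ^ (n + 1) < (volume (polarBody S)).toReal := by
    rw [← capRate_mul_sqrt_pow (by omega) hS (hκ x₀ hx₀) ha]
    exact mul_lt_mul_of_pos_left (pow_lt_pow_left₀ (Real.sqrt_lt_sqrt hc0.le (hc x₀ hx₀))
      (Real.sqrt_nonneg _) (by omega)) hg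
  obtain ⟨k, hk⟩ := (hlim.eventually (gt_mem_nhds hlt)).exists
  exact ⟨k, by rwa [div_lt_iff₀ (hδ0 k), mul_comm (volume (polarBody S)).toReal,
    add_sub_cancel] at hk⟩

end CapComparison

theorem smul_subset_polarBody_illuminationBody {n : ℕ} {S : Set (Euc n)}
    (hS : IsSymConvexBody S) {δ h : ℝ} (hδ : 0 ≤ δ) (hh0 : 0 ≤ h) (hh1 : h ≤ 1)
    (hcap : ∀ x y, IsContactPair S x y → δ * (volume (polarBody S)).toReal <
      (volume (polarCap S ((1 + h) • y))).toReal) :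
    (1 - h) • S ⊆ polarBody (illuminationBody (polarBody S) δ) := by
  rintro _ ⟨x, hx, rfl⟩ z hz
  simp only
  rcases eq_or_ne z 0 with rfl | hz0
  · simp
  obtain ⟨x', y, t, ht, hxy, rfl, -⟩ := exists_isContactPair_smul hS hz0
  have hth : t ≤ 1 + h := by
    by_contra! hlt
    rw [mem_illuminationBody_polarBody_iff hS hδ] at hz
    have := ENNReal.toReal_mono (volume_polarCap_ne_top hS (t • y))
      (measure_mono (polarCap_smul_subset hS (y := y) (by linarith) hlt.le))
    exact absurd ((hcap x' y hxy).trans_le (this.trans hz)) (lt_irrefl _)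
  have h1 : ⟪y, x⟫ ≤ 1 := by rw [real_inner_comm]; exact hxy.2.1 x hx
  rw [inner_smul_left, inner_smul_right, conj_trivial]
  have h2 : 0 ≤ 1 - h := by linarith
  calc t * ((1 - h) * ⟪y, x⟫) ≤ t * ((1 - h) * 1) := by gcongr
    _ ≤ (1 + h) * ((1 - h) * 1) := by gcongr
    _ ≤ 1 := by nlinarith

theorem polarBody_illuminationBody_subset_smul {n : ℕ} {S : Set (Euc n)}
    (hS : IsSymConvexBody S) {δ μ : ℝ} (hδ : 0 ≤ δ) (hμ : 0 < μ)
    (hcap : ∀ x y, IsContactPair S x y →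
      (volume (polarCap S (μ⁻¹ • y))).toReal ≤ δ * (volume (polarBody S)).toReal) :
    polarBody (illuminationBody (polarBody S) δ) ⊆ μ • S := by
  intro x' hx'
  rw [mem_smul_set_iff_inv_smul_mem₀ hμ.ne']
  by_contra hcon
  obtain ⟨y, hy, hlt⟩ := exists_mem_polarBody_of_notMem hS hcon
  have hy0 : y ≠ 0 := by
    rintro rfl
    rw [inner_zero_right] at hlt
    linarith
  obtain ⟨x, y', t, ht, hxy, rfl, hte⟩ := exists_isContactPair_smul hS hy0
  have ht1 : t ≤ 1 := hte.trans_le (hy x hxy.1)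
  have h1 := hx' _ ((mem_illuminationBody_polarBody_iff hS hδ).2 (hcap x y' hxy))
  rw [inner_smul_left, inner_smul_right, conj_trivial] at hlt
  rw [inner_smul_left, conj_trivial, real_inner_comm] at h1
  nlinarith

theorem exists_tendsto_zero_of_eventually {P : ℝ → ℝ → Prop}
    (hP : ∀ η, 0 < η → η < 1 → ∀ᶠ δ in 𝓝[>] 0, P η δ) :
    ∃ Ψ : ℝ → ℝ, (∀ δ, 0 ≤ Ψ δ) ∧ Tendsto Ψ (𝓝[>] 0) (𝓝 0) ∧ ∀ᶠ δ in 𝓝[>] 0, P (Ψ δ) δ := by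
  set A : ℝ → Set ℝ := fun δ => {η | 0 < η ∧ P η δ} with hA
  have key : ∀ δ, ∃ η, 0 ≤ η ∧ ((A δ).Nonempty → 0 < δ → η ∈ A δ ∧ η < sInf (A δ) + δ) := by
    intro δ
    by_cases h : (A δ).Nonempty ∧ 0 < δ
    · obtain ⟨η, hη, hlt⟩ := Real.lt_sInf_add_pos h.1 h.2
      exact ⟨η, hη.1.le, fun _ _ => ⟨hη, hlt⟩⟩
    · exact ⟨0, le_rfl, fun h1 h2 => absurd ⟨h1, h2⟩ h⟩
  choose Ψ hΨ0 hΨ using key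
  refine ⟨Ψ, hΨ0, ?_, ?_⟩
  · rw [Metric.tendsto_nhds]
    intro ε hε
    have h0 : 0 < min (ε / 2) (1 / 2) := by positivity
    have hδ : ∀ᶠ δ : ℝ in 𝓝[>] 0, δ < ε / 2 :=
      (gt_mem_nhds (half_pos hε)).filter_mono nhdsWithin_le_nhds
    filter_upwards [hP _ h0 ((min_le_right _ _).trans_lt (by norm_num)), hδ,
      self_mem_nhdsWithin] with δ h1 h2 h3
    have hmem : min (ε / 2) (1 / 2) ∈ A δ := ⟨h0, h1⟩
    have h4 := (hΨ δ ⟨_, hmem⟩ h3).2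
    have h5 : sInf (A δ) ≤ min (ε / 2) (1 / 2) := csInf_le ⟨0, fun _ h => h.1.le⟩ hmem
    rw [Real.dist_0_eq_abs, abs_of_nonneg (hΨ0 δ)]
    linarith [min_le_left (ε / 2) (1 / 2 : ℝ)]
  · filter_upwards [hP (1 / 2) (by norm_num) (by norm_num), self_mem_nhdsWithin] with δ h1 h3
    exact (hΨ δ ⟨1 / 2, by norm_num, h1⟩ h3).1.2

/-- Corollary 3.5: for `S` of class `C²₊` there is a nonnegative function `Ψ` with `Ψ(δ) → 0`
such that, with `c̃(S,n) = n^{2/(n+1)} c(S,n) c(S°,n)`,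
`(1 − (1+Ψ(δ))(c̃/G_min)δ^{2/(n+1)})S ⊆ ((S°)^δ)° ⊆ (1 − (1−Ψ(δ))(c̃/G_max)δ^{2/(n+1)})S`. -/
theorem statement8 {n : ℕ} (hn : 2 ≤ n) (S : Set (Euc n))
    (u : Euc n → Euc n) (κ : Euc n → ℝ)
    (hS : IsSymConvexBody S) (hC2 : IsC2Body S u κ)
    (hκ : ∀ x ∈ frontier S, 0 < κ x) :
    ∃ Ψ : ℝ → ℝ, (∀ δ, 0 ≤ Ψ δ) ∧ Tendsto Ψ (𝓝[>] 0) (𝓝 0) ∧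
      ∃ δ₀ > (0:ℝ), ∀ δ : ℝ, 0 < δ → δ < δ₀ →
        (1 - (1 + Ψ δ) * ((n:ℝ) ^ ((2:ℝ)/(n+1)) * cConst n S * cConst n (polarBody S)
              / sInf (Gfun S u κ '' frontier S)) * δ ^ ((2:ℝ)/(n+1))) • S
            ⊆ polarBody (illuminationBody (polarBody S) δ) ∧
          polarBody (illuminationBody (polarBody S) δ) ⊆
            (1 - (1 - Ψ δ) * ((n:ℝ) ^ ((2:ℝ)/(n+1)) * cConst n S * cConst n (polarBody S)
              / sSup (Gfun S u κ '' frontier S)) * δ ^ ((2:ℝ)/(n+1))) • S := by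
  obtain ⟨hm0, hbd⟩ := exists_Gfun_bounds hn hS hC2 hκ
  obtain ⟨x₁, hx₁⟩ := hS.frontier_nonempty (by omega)
  have hM0 := (hm0.trans_le (hbd x₁ hx₁).1).trans_le (hbd x₁ hx₁).2
  have hC : 0 < (n : ℝ) ^ ((2 : ℝ) / (n + 1)) * cConst n S * cConst n (polarBody S) := by
    have := hS.cConst_pos
    have := hS.cConst_polarBody_pos
    have : (0 : ℝ) < n := by exact_mod_cast (by omega : 0 < n)
    positivity
  have hp : (0 : ℝ) < (2 : ℝ) / (n + 1) := by positivity
  set C := (n : ℝ) ^ ((2 : ℝ) / (n + 1)) * cConst n S * cConst n (polarBody S) with hCd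
  set m := sInf (Gfun S u κ '' frontier S)
  set M := sSup (Gfun S u κ '' frontier S)
  have hA : 0 < C / m := div_pos hC hm0
  have hB : 0 < C / M := div_pos hC hM0
  have hsmall : ∀ c : ℝ, 0 < c →
      ∀ᶠ δ : ℝ in 𝓝[>] 0, c * δ ^ ((2 : ℝ) / (n + 1)) < 1 := fun c hc => by
    have h1 : Tendsto (fun δ : ℝ => c * δ ^ ((2 : ℝ) / (n + 1))) (𝓝 0) (𝓝 0) := by
      have := ((tendsto_id (α := ℝ) (x := 𝓝 0)).rpow_const (p := (2 : ℝ) / (n + 1))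
        (Or.inr hp.le)).const_mul c
      simpa [Real.zero_rpow hp.ne'] using this
    exact (h1.eventually (gt_mem_nhds one_pos)).filter_mono nhdsWithin_le_nhds
  obtain ⟨Ψ, hΨ0, hΨ, hev⟩ := exists_tendsto_zero_of_eventually (P := fun η δ =>
    (1 - (1 + η) * (C / m) * δ ^ ((2 : ℝ) / (n + 1))) • S ⊆
        polarBody (illuminationBody (polarBody S) δ) ∧
      polarBody (illuminationBody (polarBody S) δ) ⊆
        (1 - (1 - η) * (C / M) * δ ^ ((2 : ℝ) / (n + 1))) • S) (by
    intro η hη0 hη1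
    have hcA : 0 < (1 + η) * (C / m) := by positivity
    have hcB : 0 < (1 - η) * (C / M) := mul_pos (by linarith) hB
    have hlt1 : ∀ x ∈ frontier S, C / Gfun S u κ x < (1 + η) * (C / m) := fun x hx => by
      have h1 : C / Gfun S u κ x ≤ C / m := div_le_div_of_nonneg_left hC.le hm0 (hbd x hx).1
      nlinarith
    have hlt2 : ∀ x ∈ frontier S, (1 - η) * (C / M) < C / Gfun S u κ x := fun x hx => by
      have h1 : C / M ≤ C / Gfun S u κ x :=
        div_le_div_of_nonneg_left hC.le (hm0.trans_le (hbd x hx).1) (hbd x hx).2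
      nlinarith
    filter_upwards [eventually_lt_volume_polarCap hn hS hC2 hκ hcA hlt1,
      eventually_volume_polarCap_lt hn hS hC2 hκ hcB hlt2, hsmall _ hcA, hsmall _ hcB,
      self_mem_nhdsWithin] with δ h1 h2 h3 h4 hδ
    have hδ0 : 0 < δ := hδ
    exact ⟨smul_subset_polarBody_illuminationBody hS hδ0.le (by positivity) h3.le h1,
      polarBody_illuminationBody_subset_smul hS hδ0.le (by linarith)
        fun x y hxy => (h2 x y hxy).le⟩)
  obtain ⟨δ₀, hδ₀, hsub⟩ := mem_nhdsGT_iff_exists_Ioo_subset.1 hev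
  exact ⟨Ψ, hΨ0, hΨ, δ₀, hδ₀, fun δ h0 h1 => hsub ⟨h0, h1⟩⟩
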